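/- arXiv:2409.12316 — 2 statements merged into one kernel-verified Lean document; each statement's English description precedes it below -/
import Mathlib

section
/- Let d ≥ 3 and N ≥ 3, and let α be an N×N skew-symmetric matrix with entries in {−1,0,1} and no zero row. Assume that for every prime p the Main Conjecture holds over the algebraic closure of F_p for every irreducible skew-symmetric matrix with entries in {−1,0,1} of size at most N. Set N̄ = ⌊N/2⌋ N₂(d) + (N−2)(d−1) + 1, where N₂(d) = 4d(4d² + 2d − 1) + 6d + 4. Then there exists a constant C_{d,N} such that for every function Φ: ℝ^{Nd} → ℝ with ‖Φ‖_{0,N̄} < ∞ and every L ≥ 2, |S_{L,N}(Φ)| ≤ C_{d,N} ‖Φ‖_{0,N̄}. -/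
open MvPolynomial

/-- `N₂(d) = 4d(4d² + 2d − 1) + 6d + 4`. -/
def N2 (d : ℕ) : ℕ := 4 * d * (4 * d ^ 2 + 2 * d - 1) + 6 * d + 4

/-- The quadratic polynomial `q_j` (paper index `j+2`, `j : Fin (N-2)`) over a commutative
ring `K`, for an integer matrix `α` (whose entries are cast into `K`) and a fixed pair
`(z₁, v)`; the variables `(z₂,…,z_{N-1})` are indexed by `Fin (N-2) × Fin d`. -/
noncomputable def qPolyInt (N d : ℕ) (K : Type*) [CommRing K]
    (α : Matrix (Fin N) (Fin N) ℤ) (z1 v : Fin d → K) (j : Fin (N - 2)) :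
    MvPolynomial (Fin (N - 2) × Fin d) K :=
  ∑ k : Fin d,
    X (j, k) *
      (C ((α ⟨j.1 + 1, by have := j.2; omega⟩ ⟨0, by have := j.2; omega⟩ : ℤ) * z1 k +
            (α ⟨j.1 + 1, by have := j.2; omega⟩ ⟨N - 1, by have := j.2; omega⟩ : ℤ) * v k) +
        ∑ i : Fin (N - 2),
          C (((α ⟨j.1 + 1, by have := j.2; omega⟩ ⟨i.1 + 1, by have := i.2; omega⟩ -
                  α ⟨j.1 + 1, by have := j.2; omega⟩ ⟨N - 1, by have := j.2; omega⟩ *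
                    α ⟨0, by have := j.2; omega⟩ ⟨i.1 + 1, by have := i.2; omega⟩ : ℤ) : K)) *
            X (i, k))

/-- An `N × N` matrix is irreducible: there is no partition of the index set into two
nonempty sets `I`, `J` with `α i j = 0` for all `i ∈ I`, `j ∈ J`. -/
def MatIrreducible {N : ℕ} (α : Matrix (Fin N) (Fin N) ℤ) : Prop :=
  ∀ I : Set (Fin N), I.Nonempty → Iᶜ.Nonempty → ∃ i ∈ I, ∃ j ∈ Iᶜ, α i j ≠ 0

/-- The Main Conjecture for the (normalized, `α_{1N} = 1`) integer matrix `α` over the field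
`K`: for every `(z₁,v) ∈ Q₁ ∩ A₂` the affine algebraic set `Q(z₁,v) ⊆ K^{(N-2)d}` has Krull
dimension `(N-2)(d-1)` (the Krull dimension of an affine algebraic set being that of its
coordinate ring). -/
def MainConj (N d : ℕ) (K : Type*) [Field K] (α : Matrix (Fin N) (Fin N) ℤ) : Prop :=
  ∀ z1 v : Fin d → K, (∑ k : Fin d, z1 k * v k) = 0 → z1 ≠ 0 → v ≠ 0 →
    ringKrullDim (MvPolynomial (Fin (N - 2) × Fin d) K ⧸
        MvPolynomial.vanishingIdeal K
          {w | ∀ j, MvPolynomial.eval w (qPolyInt N d K α z1 v j) = 0}) =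
      (((N - 2) * (d - 1) : ℕ) : WithBot ℕ∞)

/-- The sum `S_{L,N}(Φ) = L^{N(1-d)} Σ Φ(z)`, over the points `z ∈ ℤ_L^{Nd}` all of whose
components `z_j ∈ ℝ^d` are nonzero and which satisfy all the resonance conditions
`ω_j(z) = z_j · Σ_i α_{ji} z_i = 0`. -/
noncomputable def S_LN (N d : ℕ) (α : Matrix (Fin N) (Fin N) ℤ) (L : ℝ)
    (Φ : (Fin N → Fin d → ℝ) → ℝ) : ℝ :=
  L ^ ((N : ℤ) * (1 - (d : ℤ))) *
    ∑' a : Fin N → Fin d → ℤ,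
      Set.indicator
        {a : Fin N → Fin d → ℤ |
          (∀ j : Fin N,
            ∑ k : Fin d, ((a j k : ℝ) / L) * ∑ i : Fin N, (α j i : ℝ) * ((a i k : ℝ) / L)
              = 0) ∧
          ∀ j : Fin N, ∃ k : Fin d, a j k ≠ 0}
        (fun a => Φ fun j k => (a j k : ℝ) / L) a

section PartA1

open MvPolynomial

theorem eval_finSucc_cons {K : Type} [Field K] {k : ℕ} (P : MvPolynomial (Fin (k+1)) K) (c : K)
    (x : Fin k → K) :
    eval x (Polynomial.eval (C c) (finSuccEquiv K k P)) = eval (Fin.cons c x : Fin (k+1) → K) P := by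
  rw [eval_eq_eval_mv_eval']
  rw [Polynomial.eval_map, ← Polynomial.eval₂_id, Polynomial.hom_eval₂]
  simp

theorem degreeOf_eval_finSucc {K : Type} [Field K] {k Δ : ℕ} (P : MvPolynomial (Fin (k+1)) K) (c : K)
    (h : ∀ i, P.degreeOf i ≤ Δ) (i : Fin k) :
    (Polynomial.eval (C c) (finSuccEquiv K k P)).degreeOf i ≤ Δ := by
  rw [Polynomial.eval_eq_sum_range]
  refine (degreeOf_sum_le i _ _).trans (Finset.sup_le fun j _ => ?_)
  rw [← map_pow, mul_comm]
  refine (degreeOf_C_mul_le _ _ _).trans ?_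
  exact (degreeOf_coeff_finSuccEquiv P i j).trans (h _)

theorem fiber_count (Δ : ℕ) : ∀ n k : ℕ, ∃ B : ℕ, ∀ (K : Type) [Field K] (F : Finset K)
    (X : Finset (Fin n → K)), (∀ x ∈ X, ∀ i, x i ∈ F) →
    (∀ e : Fin k → Fin n, ∃ P : MvPolynomial (Fin k) K, P ≠ 0 ∧ (∀ i, P.degreeOf i ≤ Δ) ∧
      ∀ x ∈ X, eval (x ∘ e) P = 0) → X.card * F.card ≤ B * F.card ^ k := by
  intro n
  induction n with
  | zero =>
    intro k
    refine ⟨1, fun K _ F X hF h => ?_⟩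
    have hX : X.card ≤ 1 := by
      rw [Finset.card_le_one]; intro a _ b _; exact Subsingleton.elim _ _
    rcases k with _ | k
    · obtain ⟨P, hP, -, hv⟩ := h Fin.elim0
      have : X = ∅ := by
        rw [Finset.eq_empty_iff_forall_notMem]
        intro x hx
        have := hv x hx
        rw [eq_C_of_isEmpty P] at this hP
        simp at this hP
        exact hP this
      simp [this]
    · rw [one_mul]
      calc X.card * F.card ≤ 1 * F.card := Nat.mul_le_mul_right _ hX
        _ = F.card := one_mul _
        _ ≤ _ := Nat.le_self_pow (by omega) _
  | succ n ih =>
    intro k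
    rcases k with _ | k
    · refine ⟨1, fun K _ F X hF h => ?_⟩
      obtain ⟨P, hP, -, hv⟩ := h Fin.elim0
      have : X = ∅ := by
        rw [Finset.eq_empty_iff_forall_notMem]
        intro x hx
        have := hv x hx
        rw [eq_C_of_isEmpty P] at this hP
        simp at this hP
        exact hP this
      simp [this]
    · obtain ⟨B1, h1⟩ := ih k
      obtain ⟨B2, h2⟩ := ih (k+1)
      refine ⟨B1 + B2 * (n ^ k * Δ), fun K _ F X hF h => ?_⟩
      classical
      choose P hP0 hPd hPv using fun e' : Fin k → Fin n => h (Fin.cons 0 (Fin.succ ∘ e'))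
      let bad : Finset K := Finset.univ.biUnion fun e' : Fin k → Fin n =>
        F.filter fun c => Polynomial.eval (C c) (finSuccEquiv K k (P e')) = 0
      have hbad : bad.card ≤ n ^ k * Δ := by
        refine (Finset.card_biUnion_le_card_mul _ _ Δ ?_).trans ?_
        · intro e' _
          have hne : finSuccEquiv K k (P e') ≠ 0 := by
            simpa using hP0 e'
          have hsub : ((F.filter fun c => Polynomial.eval (C c) (finSuccEquiv K k (P e')) = 0).image
              (C : K → MvPolynomial (Fin k) K)) ⊆ (finSuccEquiv K k (P e')).roots.toFinset := by
            intro y hy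
            simp only [Finset.mem_image, Finset.mem_filter] at hy
            obtain ⟨c, ⟨_, hc⟩, rfl⟩ := hy
            simp [hne, hc, Polynomial.IsRoot]
          have h3 := Finset.card_le_card hsub
          rw [Finset.card_image_of_injective _ (C_injective _ _)] at h3
          refine h3.trans ((Multiset.toFinset_card_le _).trans ?_)
          refine (Polynomial.card_roots' _).trans ?_
          rw [natDegree_finSuccEquiv]; exact hPd _ _
        · simp
      let Y : K → Finset (Fin n → K) := fun c => (X.filter fun x => x 0 = c).image Fin.tail
      have hYc : ∀ c, (Y c).card = (X.filter fun x => x 0 = c).card := by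
        intro c
        apply Finset.card_image_of_injOn
        intro x hx y hy hxy
        simp only [Finset.coe_filter, Set.mem_setOf_eq] at hx hy
        rw [← Fin.cons_self_tail x, ← Fin.cons_self_tail y, hx.2, hy.2]
        exact congrArg _ hxy
      have hX : X.card = ∑ c ∈ F, (Y c).card := by
        rw [Finset.card_eq_sum_card_fiberwise (f := fun x => x 0) (t := F)]
        · exact Finset.sum_congr rfl fun c _ => (hYc c).symm
        · intro x hx; exact hF x hx 0
      have hYF : ∀ c, ∀ y ∈ Y c, ∀ i, y i ∈ F := by
        intro c y hy i
        simp only [Y, Finset.mem_image, Finset.mem_filter] at hy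
        obtain ⟨x, ⟨hx, _⟩, rfl⟩ := hy
        exact hF x hx _
      have hb : ∀ c, (Y c).card * F.card ≤ B2 * F.card ^ (k+1) := by
        intro c
        apply h2 K F (Y c) (hYF c)
        intro e
        obtain ⟨Q, hQ, hQd, hQv⟩ := h (Fin.succ ∘ e)
        refine ⟨Q, hQ, hQd, ?_⟩
        intro y hy
        simp only [Y, Finset.mem_image, Finset.mem_filter] at hy
        obtain ⟨x, ⟨hx, _⟩, rfl⟩ := hy
        exact hQv x hx
      have hg : ∀ c ∈ F \ bad, (Y c).card * F.card ≤ B1 * F.card ^ k := by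
        intro c hc
        apply h1 K F (Y c) (hYF c)
        intro e
        refine ⟨Polynomial.eval (C c) (finSuccEquiv K k (P e)), ?_, 
          degreeOf_eval_finSucc _ _ (hPd e), ?_⟩
        · intro h0
          simp only [Finset.mem_sdiff] at hc
          apply hc.2
          simp only [bad, Finset.mem_biUnion, Finset.mem_filter]
          exact ⟨e, Finset.mem_univ _, hc.1, h0⟩
        · intro y hy
          simp only [Y, Finset.mem_image, Finset.mem_filter] at hy
          obtain ⟨x, ⟨hx, rfl⟩, rfl⟩ := hy
          rw [eval_finSucc_cons, ← hPv e x hx]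
          congr 2
          ext i
          refine Fin.cases ?_ (fun j => ?_) i <;> simp [Fin.tail]
      have hbF : bad ⊆ F := by
        intro c hc
        simp only [bad, Finset.mem_biUnion, Finset.mem_filter] at hc
        exact hc.choose_spec.2.1
      rw [hX, Finset.sum_mul, ← Finset.sum_sdiff hbF]
      have e1 : ∑ c ∈ F \ bad, (Y c).card * F.card ≤ F.card * (B1 * F.card ^ k) := by
        refine (Finset.sum_le_card_nsmul _ _ _ hg).trans ?_
        rw [smul_eq_mul]
        exact Nat.mul_le_mul_right _ (Finset.card_le_card Finset.sdiff_subset)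
      have e2 : ∑ c ∈ bad, (Y c).card * F.card ≤ (n ^ k * Δ) * (B2 * F.card ^ (k+1)) := by
        refine (Finset.sum_le_card_nsmul _ _ _ (fun c _ => hb c)).trans ?_
        rw [smul_eq_mul]
        exact Nat.mul_le_mul_right _ hbad
      refine (Nat.add_le_add e1 e2).trans (le_of_eq ?_)
      ring

end PartA1

section PartA2

open MvPolynomial

theorem alg_relation {K : Type} [Field K] {σ τ : Type} [Fintype σ] [Fintype τ]
    (n : ℕ) (hσ : Fintype.card σ = n) (hτ : Fintype.card τ = n + 1)
    (f : τ → MvPolynomial σ K) (hf : ∀ i, (f i).totalDegree ≤ 2) :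
    ∃ P : MvPolynomial τ K, P ≠ 0 ∧ (∀ i, P.degreeOf i ≤ (2 * (n + 1)) ^ n) ∧ aeval f P = 0 := by
  classical
  set t := (2 * (n + 1)) ^ n with ht
  let E := τ → Fin (t + 1)
  let G := σ → Fin (2 * t * (n + 1) + 1)
  let toF : E → (τ →₀ ℕ) := fun s => Finsupp.equivFunOnFinite.symm fun i => (s i : ℕ)
  have htoF : Function.Injective toF := by
    intro s s' h
    ext i
    have := DFunLike.congr_fun h i
    simpa [toF] using this
  let mk : (E → K) →ₗ[K] MvPolynomial τ K := ∑ s : E, (monomial (toF s)).comp (LinearMap.proj s)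
  have hmk : ∀ c, mk c = ∑ s : E, monomial (toF s) (c s) := by
    intro c; simp [mk]
  have hcoeff : ∀ c s, coeff (toF s) (mk c) = c s := by
    intro c s
    rw [hmk, coeff_sum]
    rw [Finset.sum_eq_single s]
    · simp
    · intro b _ hb
      rw [coeff_monomial, if_neg (fun h => hb (htoF h))]
    · simp
  let Λ : (E → K) →ₗ[K] (G → K) := LinearMap.pi fun g =>
    (lcoeff K (Finsupp.equivFunOnFinite.symm fun i => (g i : ℕ))).comp
      ((aeval f).toLinearMap.comp mk)
  have hrank : Module.finrank K (G → K) < Module.finrank K (E → K) := by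
    simp only [Module.finrank_fintype_fun_eq_card, E, G, Fintype.card_fun, Fintype.card_fin, hσ, hτ]
    calc (2 * t * (n + 1) + 1) ^ n ≤ ((2 * (n + 1)) * (t + 1)) ^ n := by
          apply Nat.pow_le_pow_left; nlinarith
      _ = t * (t + 1) ^ n := by rw [mul_pow]
      _ < (t + 1) * (t + 1) ^ n := by
          apply Nat.mul_lt_mul_of_pos_right (by omega); positivity
      _ = (t + 1) ^ (n + 1) := by ring
  have hker : LinearMap.ker Λ ≠ ⊥ := LinearMap.ker_ne_bot_of_finrank_lt hrank
  obtain ⟨c, hc, hc0⟩ := (Submodule.ne_bot_iff _).1 hker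
  have hdeg : ∀ i, (mk c).degreeOf i ≤ t := by
    intro i
    rw [hmk]
    refine (degreeOf_sum_le i _ _).trans (Finset.sup_le fun s _ => ?_)
    by_cases h0 : c s = 0
    · simp [h0]
    · rw [degreeOf_monomial_eq _ _ h0]
      simp only [toF, Finsupp.equivFunOnFinite_symm_apply_apply]
      have := (s i).2; omega
  refine ⟨mk c, ?_, hdeg, ?_⟩
  · intro h0
    apply hc0
    ext s
    rw [← hcoeff c s, h0]; simp
  · have htd : (aeval f (mk c)).totalDegree ≤ 2 * t * (n + 1) := by
      rw [hmk, map_sum]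
      refine (totalDegree_finsetSum _ _).trans (Finset.sup_le fun s _ => ?_)
      rw [aeval_monomial]
      refine (totalDegree_mul _ _).trans ?_
      rw [algebraMap_eq, totalDegree_C, zero_add, Finsupp.prod_fintype _ _ (by simp)]
      refine (totalDegree_finsetProd _ _).trans ?_
      calc ∑ i, ((f i) ^ (toF s i)).totalDegree ≤ ∑ i : τ, t * 2 := by
            apply Finset.sum_le_sum
            intro i _
            refine (totalDegree_pow _ _).trans ?_
            apply Nat.mul_le_mul _ (hf i)
            simp only [toF, Finsupp.equivFunOnFinite_symm_apply_apply]
            have := (s i).2; omega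
        _ = 2 * t * (n + 1) := by simp [hτ]; ring
    ext g
    rw [coeff_zero]
    by_cases hg : ∀ i, g i < 2 * t * (n + 1) + 1
    · have := congrFun (LinearMap.mem_ker.1 hc) (fun i => ⟨g i, hg i⟩)
      simp only [Λ, LinearMap.pi_apply, LinearMap.comp_apply, lcoeff_apply, Pi.zero_apply] at this
      rw [← this]
      congr 1
      ext i; simp
    · push Not at hg
      obtain ⟨i, hi⟩ := hg
      by_contra hne
      have h1 := le_totalDegree (mem_support_iff.2 hne)
      have h2 : g i ≤ g.sum fun _ e => e := by
        rw [Finsupp.sum_fintype _ _ (by simp)]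
        exact Finset.single_le_sum (f := fun i => g i) (fun _ _ => Nat.zero_le _) (Finset.mem_univ i)
      omega

end PartA2

section PartA3

open MvPolynomial

theorem height_point {K : Type} [Field K] [IsAlgClosed K] {σ : Type} [Fintype σ] (x : σ → K) :
    (vanishingIdeal K {x} : Ideal (MvPolynomial σ K)).height = Fintype.card σ := by
  have hdim : ringKrullDim (MvPolynomial σ K) = Fintype.card σ := by
    rw [MvPolynomial.ringKrullDim_of_isNoetherianRing, ringKrullDim_eq_zero_of_field]
    simp
  have : FiniteRingKrullDim (MvPolynomial σ K) := by
    rw [finiteRingKrullDim_iff_ne_bot_and_top, hdim]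
    constructor
    · exact WithBot.coe_ne_bot (a := (Fintype.card σ : ℕ∞))
    · intro h
      have : ((Fintype.card σ : ℕ∞) : WithBot ℕ∞) = ((⊤ : ℕ∞) : WithBot ℕ∞) := h
      rw [WithBot.coe_inj] at this
      exact ENat.natCast_ne_top _ this
  obtain ⟨I, hI, hh⟩ := Ideal.exists_isMaximal_height (R := MvPolynomial σ K)
  obtain ⟨y, rfl⟩ := isMaximal_iff_eq_vanishingIdeal_singleton.1 hI
  rw [hdim] at hh
  have hh' : (vanishingIdeal K {y} : Ideal (MvPolynomial σ K)).height = Fintype.card σ := by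
    exact_mod_cast hh
  rw [← hh']
  let e : MvPolynomial σ K ≃ₐ[K] MvPolynomial σ K := AlgEquiv.ofAlgHom
    (aeval fun i => X i + C (y i - x i)) (aeval fun i => X i + C (x i - y i))
    (by ext i; simp; ring) (by ext i; simp; ring)
  rw [← RingEquiv.height_comap e.toRingEquiv]
  congr 1
  ext p
  rw [mem_vanishingIdeal_singleton_iff, Ideal.mem_comap]
  erw [mem_vanishingIdeal_singleton_iff]
  have : (aeval x : MvPolynomial σ K →ₐ[K] K).comp e.toAlgHom = aeval y := by
    ext i; simp [e]
  rw [← this]; rfl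

/-- The local dimension argument. -/
theorem local_dim {K : Type} [Field K] [IsAlgClosed K] {σ : Type} [Fintype σ]
    (I : Ideal (MvPolynomial σ K)) (D : ℕ) (hD : ringKrullDim (MvPolynomial σ K ⧸ I) ≤ (D : ℕ))
    (s : Set (MvPolynomial σ K)) (x : σ → K) (hs : ∀ f ∈ s, eval x f = 0)
    (hI : ∀ 𝔭 : Ideal (MvPolynomial σ K), 𝔭.IsPrime → s ⊆ 𝔭 → 𝔭 ≤ vanishingIdeal K {x} → I ≤ 𝔭) :
    (Fintype.card σ : ℕ∞) ≤ D + s.encard := by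
  have hs' : s ⊆ (vanishingIdeal K {x} : Ideal (MvPolynomial σ K)) := by
    intro f hf
    rw [SetLike.mem_coe, mem_vanishingIdeal_singleton_iff]
    simpa [aeval_eq_eval] using hs f hf
  have h1 := Ideal.height_le_height_add_encard_of_subset s hs'
  rw [height_point] at h1
  refine h1.trans ?_
  gcongr
  have hsp : Ideal.span s ≤ (vanishingIdeal K {x} : Ideal (MvPolynomial σ K)) := Ideal.span_le.2 hs'
  have hprime : (Ideal.map (Ideal.Quotient.mk (Ideal.span s))
      (vanishingIdeal K {x} : Ideal (MvPolynomial σ K))).IsPrime :=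
    Ideal.isPrime_map_quotientMk_of_isPrime hsp
  let 𝔪 : PrimeSpectrum (MvPolynomial σ K ⧸ Ideal.span s) := ⟨_, hprime⟩
  have h2 : (Ideal.map (Ideal.Quotient.mk (Ideal.span s))
      (vanishingIdeal K {x} : Ideal (MvPolynomial σ K))).height = Order.height 𝔪 :=
    PrimeSpectrum.height_eq_orderHeight 𝔪
  rw [h2]
  have h3 := Order.height_eq_krullDim_Iic 𝔪
  have key : Order.krullDim (Set.Iic 𝔪) ≤ Order.krullDim (PrimeSpectrum.zeroLocus (R := MvPolynomial σ K) I) := by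
    have hmem : ∀ 𝔮 : Set.Iic 𝔪, PrimeSpectrum.comap (Ideal.Quotient.mk (Ideal.span s)) 𝔮.1 ∈
        PrimeSpectrum.zeroLocus (R := MvPolynomial σ K) I := by
      rintro ⟨𝔮, h𝔮⟩
      rw [PrimeSpectrum.mem_zeroLocus]
      apply hI
      · exact (PrimeSpectrum.comap (Ideal.Quotient.mk (Ideal.span s)) 𝔮).2
      · intro f hf
        show Ideal.Quotient.mk (Ideal.span s) f ∈ 𝔮.asIdeal
        rw [Ideal.Quotient.eq_zero_iff_mem.2 (Ideal.subset_span hf)]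
        exact Ideal.zero_mem _
      · intro f hf
        have hf' : Ideal.Quotient.mk (Ideal.span s) f ∈ 𝔮.asIdeal := hf
        have h4 : Ideal.Quotient.mk (Ideal.span s) f ∈ 𝔪.asIdeal := h𝔮 hf'
        have h5 : f ∈ Ideal.comap (Ideal.Quotient.mk (Ideal.span s)) (Ideal.map (Ideal.Quotient.mk (Ideal.span s))
          (vanishingIdeal K {x} : Ideal (MvPolynomial σ K))) := h4
        rw [Ideal.comap_map_of_surjective _ Ideal.Quotient.mk_surjective, ← RingHom.ker_eq_comap_bot,
          Ideal.mk_ker, sup_eq_left.2 hsp] at h5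
        exact h5
    refine Order.krullDim_le_of_strictMono (fun 𝔮 : Set.Iic 𝔪 => ⟨_, hmem 𝔮⟩) ?_
    apply Monotone.strictMono_of_injective
    · intro a b hab
      exact Ideal.comap_mono hab
    · intro a b hab
      have := congrArg Subtype.val hab
      exact Subtype.ext (PrimeSpectrum.comap_injective_of_surjective _ Ideal.Quotient.mk_surjective this)
  rw [← h3, ← ringKrullDim_quotient] at key
  exact_mod_cast key.trans hD

end PartA3

section PartA4

open MvPolynomial

theorem elim_poly {K : Type} [Field K] [IsAlgClosed K] {σ : Type} [Fintype σ] (m D n : ℕ)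
    (hm : 0 < m) (hσ : Fintype.card σ = n) (hn : D + m = n)
    (q : Fin m → MvPolynomial σ K) (hq : ∀ i, (q i).totalDegree ≤ 2)
    (hD : ringKrullDim (MvPolynomial σ K ⧸ vanishingIdeal K {w : σ → K | ∀ j, eval w (q j) = 0})
      ≤ (D : ℕ))
    (e : Fin (D + 1) → σ) :
    ∃ P : MvPolynomial (Fin (D + 1)) K, P ≠ 0 ∧ (∀ i, P.degreeOf i ≤ (2 * (n + 1)) ^ n) ∧
      ∀ x : σ → K, (∀ j, eval x (q j) = 0) → eval (x ∘ e) P = 0 := by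
  classical
  have : Infinite K := IsAlgClosed.instInfinite
  obtain ⟨G, hG0, hGd, hGr⟩ := alg_relation (τ := Fin m ⊕ Fin (D + 1)) n hσ (by simp; omega)
    (Sum.elim q (fun j => X (e j))) (by
      rintro (i | i)
      · exact hq i
      · simp [totalDegree_X])
  let A := MvPolynomial (Fin (D + 1)) K
  let i0 : Fin m := ⟨0, hm⟩
  -- a point with `G` nonvanishing
  obtain ⟨c, hc0, w, hcw⟩ : ∃ c : Fin m → K, c i0 ≠ 0 ∧ ∃ w : Fin (D + 1) → K,
      eval (Sum.elim c w) G ≠ 0 := by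
    have h1 : X (Sum.inl i0) * G ≠ 0 := mul_ne_zero (X_ne_zero _) hG0
    obtain ⟨z, hz⟩ : ∃ z, eval z (X (Sum.inl i0) * G) ≠ 0 := by
      by_contra hcon
      push Not at hcon
      exact h1 (MvPolynomial.funext fun z => by simpa using hcon z)
    rw [map_mul, eval_X] at hz
    refine ⟨z ∘ Sum.inl, left_ne_zero_of_mul hz, z ∘ Sum.inr, ?_⟩
    rw [Sum.elim_comp_inl_inr]
    exact right_ne_zero_of_mul hz
  let H : Polynomial A := aeval (Sum.elim (fun i => Polynomial.C (C (c i)) * Polynomial.X)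
    (fun j => Polynomial.C (X j))) G
  have hH0 : H ≠ 0 := by
    intro h0
    apply hcw
    have h2 : eval w (Polynomial.eval 1 H) = 0 := by simp [h0]
    rw [← h2]
    let ψ : Polynomial A →ₐ[K] K := ((aeval w : A →ₐ[K] K)).comp ((Polynomial.aeval (1 : A)).restrictScalars K)
    have : ψ.comp (aeval (Sum.elim (fun i => Polynomial.C (C (c i)) * Polynomial.X)
      (fun j => Polynomial.C (X j)))) = aeval (Sum.elim c w) := by
      ext (i | j) <;> simp [ψ, A]
    have h3 := DFunLike.congr_fun this G
    simp only [AlgHom.comp_apply, ψ, AlgHom.restrictScalars_apply, Polynomial.coe_aeval_eq_eval, aeval_eq_eval] at h3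
    exact h3.symm
  have hcoeffdeg : ∀ t i, (H.coeff t).degreeOf i ≤ (2 * (n + 1)) ^ n := by
    intro t i
    have : H = ∑ s ∈ G.support, Polynomial.monomial (∑ a : Fin m, s (Sum.inl a))
        (C (coeff s G * ∏ a : Fin m, c a ^ s (Sum.inl a)) * ∏ b : Fin (D+1), X b ^ s (Sum.inr b) : A) := by
      simp only [H, aeval_def, eval₂_eq']
      refine Finset.sum_congr rfl fun s _ => ?_
      rw [Fintype.prod_sum_type]
      simp only [Sum.elim_inl, Sum.elim_inr, mul_pow, Finset.prod_mul_distrib,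
        Finset.prod_pow_eq_pow_sum]
      rw [← Polynomial.C_mul_X_pow_eq_monomial]
      simp only [map_mul, map_prod, map_pow]
      have : algebraMap K (Polynomial A) (coeff s G) = Polynomial.C (C (coeff s G)) := rfl
      rw [this]
      ring
    rw [this, Polynomial.finsetSum_coeff]
    refine (degreeOf_sum_le i _ _).trans (Finset.sup_le fun s hs => ?_)
    rw [Polynomial.coeff_monomial]
    split_ifs
    · refine (degreeOf_C_mul_le _ _ _).trans ?_
      refine (degreeOf_prod_le _ _ _).trans ?_
      rw [Finset.sum_eq_single i]
      · refine (degreeOf_pow_le _ _ _).trans ?_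
        rw [degreeOf_X_self, mul_one]
        exact (monomial_le_degreeOf _ hs).trans (hGd _)
      · intro b _ hb
        refine Nat.le_zero.1 ((degreeOf_pow_le _ _ _).trans ?_)
        rw [degreeOf_X_of_ne (Ne.symm hb), mul_zero]
      · simp
    · simp
  obtain ⟨k, H', hH', hP0⟩ : ∃ (k : ℕ) (H' : Polynomial A), H = Polynomial.X ^ k * H' ∧ H'.coeff 0 ≠ 0 := by
    obtain ⟨H', h1, h2⟩ := Polynomial.exists_eq_pow_rootMultiplicity_mul_and_not_dvd H hH0 0
    refine ⟨_, H', by simpa using h1, ?_⟩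
    intro h3
    apply h2
    simpa using Polynomial.X_dvd_iff.2 h3
  have hPk : H'.coeff 0 = H.coeff k := by
    rw [hH']
    simpa using (Polynomial.coeff_X_pow_mul H' k 0).symm
  refine ⟨H'.coeff 0, hP0, fun i => hPk ▸ hcoeffdeg k i, ?_⟩
  intro x hx
  by_contra hne
  let s : Set (MvPolynomial σ K) := Set.range fun i : {i : Fin m // i ≠ i0} =>
    C (c i0) * q i - C (c i) * q i0
  let ε : MvPolynomial σ K := C (c i0)⁻¹ * q i0
  let φ : Polynomial A →ₐ[K] MvPolynomial σ K :=
    { Polynomial.eval₂RingHom (aeval fun j => X (e j) : A →ₐ[K] MvPolynomial σ K).toRingHom ε with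
      commutes' := fun r => by
        have : algebraMap K (Polynomial A) r = Polynomial.C (C r) := rfl
        simp [this, A, algebraMap_eq] }
  have hφX : φ Polynomial.X = ε := Polynomial.eval₂_X _ _
  have hφC : ∀ a, φ (Polynomial.C a) = aeval (fun j => X (e j)) a := by intro a; exact Polynomial.eval₂_C _ _
  have hmem : φ H ∈ Ideal.span s := by
    rw [← Ideal.Quotient.eq_zero_iff_mem]
    have h1 : ((Ideal.Quotient.mkₐ K (Ideal.span s)).comp φ).comp
        (aeval (Sum.elim (fun i => Polynomial.C (C (c i)) * Polynomial.X)
          (fun j => Polynomial.C (X j)))) = (Ideal.Quotient.mkₐ K (Ideal.span s)).comp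
            (aeval (Sum.elim q (fun j => X (e j)))) := by
      apply MvPolynomial.algHom_ext
      rintro (i | j)
      · simp only [AlgHom.comp_apply, aeval_X, Sum.elim_inl, map_mul]
        rw [← map_mul, hφX, hφC]
        simp only [Ideal.Quotient.mkₐ_eq_mk]
        rw [Ideal.Quotient.eq]
        have : aeval (fun j => X (e j)) (C (c i) : A) = (C (c i) : MvPolynomial σ K) := by
          simp [A]
        rw [this]
        by_cases hi : i = i0
        · have : C (c i) * ε - q i = 0 := by
            simp only [ε, hi, ← mul_assoc, ← C_mul]
            rw [mul_inv_cancel₀ hc0]; simp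
          rw [this]; exact Ideal.zero_mem _
        · have : C (c i) * ε - q i = C (-(c i0)⁻¹) * (C (c i0) * q i - C (c i) * q i0) := by
            have h5 : (C (c i0)⁻¹ * C (c i0) : MvPolynomial σ K) = 1 := by
              rw [← C_mul, inv_mul_cancel₀ hc0, C_1]
            simp only [ε, C_neg]
            linear_combination (q i) * h5
          rw [this]
          exact Ideal.mul_mem_left _ _ (Ideal.subset_span ⟨⟨i, hi⟩, rfl⟩)
      · simp only [AlgHom.comp_apply, aeval_X, Sum.elim_inr, hφC]
    have h2 := DFunLike.congr_fun h1 G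
    simp only [AlgHom.comp_apply, hGr, map_zero] at h2
    exact h2
  have hφH : φ H = ε ^ k * φ H' := by rw [hH', map_mul, map_pow, hφX]
  have hgx : eval x (φ H') ≠ 0 := by
    have h1 : H' = Polynomial.X * H'.divX + Polynomial.C (H'.coeff 0) := (Polynomial.X_mul_divX_add H').symm
    rw [h1, map_add, map_mul, hφX, hφC, map_add, map_mul]
    have h2 : eval x ε = 0 := by simp [ε, hx]
    rw [h2, zero_mul, zero_add]
    intro h3
    apply hne
    rw [← h3]
    have : (aeval x : MvPolynomial σ K →ₐ[K] K).comp (aeval fun j => X (e j)) = aeval (x ∘ e) := by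
      ext j; simp
    exact (DFunLike.congr_fun this (H'.coeff 0)).symm
  have hfin := local_dim _ D hD s x (by
      rintro f ⟨i, rfl⟩
      simp [hx]) (by
    intro 𝔭 hp hs hle
    have hspan : Ideal.span s ≤ 𝔭 := Ideal.span_le.2 hs
    have h1 := hspan hmem
    rw [hφH] at h1
    have h2 : ε ∈ 𝔭 := by
      rcases hp.mem_or_mem h1 with h | h
      · exact hp.mem_of_pow_mem _ h
      · exfalso
        apply hgx
        have := hle h
        rw [mem_vanishingIdeal_singleton_iff] at this
        simpa [aeval_eq_eval] using this
    have h3 : q i0 ∈ 𝔭 := by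
      have h4 : q i0 = C (c i0) * ε := by
        simp only [ε, ← mul_assoc, ← C_mul]
        rw [mul_inv_cancel₀ hc0]; simp
      rw [h4]; exact Ideal.mul_mem_left _ _ h2
    have h4 : ∀ i, q i ∈ 𝔭 := by
      intro i
      by_cases hi : i = i0
      · rw [hi]; exact h3
      · have h5 : C (c i0) * q i - C (c i) * q i0 ∈ 𝔭 := hs ⟨⟨i, hi⟩, rfl⟩
        have h6 : C (c i0) * q i ∈ 𝔭 := by
          have := Ideal.add_mem _ h5 (Ideal.mul_mem_left 𝔭 (C (c i)) h3)
          simpa using this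
        have h7 : q i = C (c i0)⁻¹ * (C (c i0) * q i) := by
          rw [← mul_assoc, ← C_mul, inv_mul_cancel₀ hc0]; simp
        rw [h7]; exact Ideal.mul_mem_left _ _ h6
    have h5 := IsPrime.vanishingIdeal_zeroLocus (K := K) 𝔭
    rw [← h5]
    apply vanishingIdeal_anti_mono
    intro y hy j
    have := (mem_zeroLocus_iff.1 hy) (q j) (h4 j)
    simpa [aeval_eq_eval] using this)
  have hcard : s.encard ≤ (m - 1 : ℕ) := by
    have h1 : s.encard ≤ (Set.univ : Set {i : Fin m // i ≠ i0}).encard := by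
      simp only [s, ← Set.image_univ]
      exact Set.encard_image_le _ _
    refine h1.trans ?_
    rw [Set.encard_univ, ENat.card_eq_coe_fintype_card]
    have : Fintype.card {i : Fin m // i ≠ i0} = m - 1 := by
      rw [Fintype.card_subtype_compl]; simp
    rw [this]
  rw [hσ] at hfin
  have h9 : (n : ℕ∞) ≤ ((D + (m - 1) : ℕ) : ℕ∞) := by
    push_cast
    refine hfin.trans ?_
    gcongr
    exact_mod_cast hcard
  have h10 : n ≤ D + (m - 1) := by exact_mod_cast h9
  omega

/-- Uniform bound for the number of points with coordinates in a finite set. -/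
theorem variety_count (n D : ℕ) : ∃ B : ℕ, ∀ (m : ℕ), D + m = n → ∀ (K : Type) [Field K] [IsAlgClosed K]
    (σ : Type) [Fintype σ], Fintype.card σ = n → (0 < n → 0 < m) → ∀ q : Fin m → MvPolynomial σ K,
    (∀ i, (q i).totalDegree ≤ 2) →
    ringKrullDim (MvPolynomial σ K ⧸ vanishingIdeal K {w : σ → K | ∀ j, eval w (q j) = 0})
      ≤ (D : ℕ) → ∀ (F : Finset K) (Y : Finset (σ → K)), (∀ x ∈ Y, ∀ i, x i ∈ F) →
      (∀ x ∈ Y, ∀ j, eval x (q j) = 0) → F.Nonempty → Y.card ≤ B * F.card ^ D := by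
  classical
  obtain ⟨B, hB⟩ := fiber_count ((2 * (n + 1)) ^ n) n (D + 1)
  refine ⟨B, ?_⟩
  intro m hmn K _ _ σ _ hσ hm q hq hD F Y hF hY hFne
  let u : σ ≃ Fin n := Fintype.equivFinOfCardEq hσ
  have h1 := hB K F (Y.image fun y => y ∘ u.symm) (by
      intro x hx i
      obtain ⟨y, hy, rfl⟩ := Finset.mem_image.1 hx
      exact hF y hy _) (by
      intro e
      have hn0 : 0 < n := lt_of_le_of_lt (Nat.zero_le _) (e 0).2
      obtain ⟨P, hP0, hPd, hPv⟩ := elim_poly m D n (hm hn0) hσ hmn q hq hD (u.symm ∘ e)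
      refine ⟨P, hP0, hPd, ?_⟩
      intro x hx
      obtain ⟨y, hy, rfl⟩ := Finset.mem_image.1 hx
      exact hPv y (hY y hy))
  rw [Finset.card_image_of_injective] at h1
  · rw [pow_succ, ← mul_assoc] at h1
    exact Nat.le_of_mul_le_mul_right h1 hFne.card_pos
  · intro a b hab
    exact (u.symm.surjective.injective_comp_right) hab

end PartA4

section PartB1

open Finset

theorem residue_count (m R : ℕ) (hm : 0 < m) (c : ZMod m) :
    ((Finset.Icc (-(R : ℤ)) R).filter fun x : ℤ => (x : ZMod m) = c).card ≤ 2 * R / m + 1 := by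
  rw [← Finset.card_range (2 * R / m + 1)]
  apply Finset.card_le_card_of_injOn (fun x : ℤ => ((x + R) / m).toNat)
  · intro x hx
    simp only [Finset.coe_filter, Finset.mem_Icc] at hx
    obtain ⟨⟨h1, h2⟩, -⟩ := hx
    simp only [Finset.coe_range, Set.mem_Iio]
    have h3 : (x + R) / (m : ℤ) ≤ (2 * R : ℤ) / m := Int.ediv_le_ediv (by exact_mod_cast hm) (by omega)
    have h4 : ((2 * R / m : ℕ) : ℤ) = (2 * R : ℤ) / m := by push_cast; rfl
    have h5 : ((x + R) / (m : ℤ)).toNat ≤ 2 * R / m := by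
      rw [Int.toNat_le, h4]; exact h3
    exact Nat.lt_succ_of_le h5
  · intro x hx y hy hxy
    simp only [Finset.coe_filter, Finset.mem_Icc] at hx hy
    obtain ⟨⟨h1, h2⟩, h3⟩ := hx
    obtain ⟨⟨h1', h2'⟩, h3'⟩ := hy
    simp only at hxy
    have h4 : ((x : ℤ) : ZMod m) = (y : ℤ) := h3.trans h3'.symm
    rw [ZMod.intCast_eq_intCast_iff] at h4
    have h5 : (x + R) % m = (y + R) % m := Int.ModEq.add_right _ h4
    have p1 : 0 ≤ (x + R) / (m : ℤ) := Int.ediv_nonneg (by omega) (by omega)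
    have p2 : 0 ≤ (y + R) / (m : ℤ) := Int.ediv_nonneg (by omega) (by omega)
    have h6 : (x + R) / (m : ℤ) = (y + R) / m := by omega
    have e1 := Int.emod_add_mul_ediv (x + R) m
    have e2 := Int.emod_add_mul_ediv (y + R) m
    rw [h5, h6] at e1
    omega

theorem zmod_pairs (m e : ℕ) (hm : 0 < m) (he : 1 ≤ e) [NeZero m] :
    ((Finset.univ : Finset ((Fin e → ZMod m) × (Fin e → ZMod m))).filter
      fun z => ∑ k, z.1 k * z.2 k = 0).card ≤ m ^ e * ∑ h ∈ m.divisors, h ^ (e - 1) := by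
  classical
  let f : (Fin e → ZMod m) → ((Fin e → ZMod m) →+ ZMod m) := fun x =>
    { toFun := fun y => ∑ k, x k * y k
      map_zero' := by simp
      map_add' := fun a b => by simp [mul_add, Finset.sum_add_distrib] }
  let hh : (Fin e → ZMod m) → ℕ := fun x => Nat.card (f x).range
  have hker : ∀ x, Nat.card (f x).ker * hh x = m ^ e := by
    intro x
    have := AddSubgroup.card_eq_card_quotient_mul_card_addSubgroup (f x).ker
    rw [Nat.card_congr (QuotientAddGroup.quotientKerEquivRange (f x)).toEquiv] at this
    rw [mul_comm, ← this]; simp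
  have hdvd : ∀ x, hh x ∣ m := by
    intro x
    have := AddSubgroup.card_addSubgroup_dvd_card (f x).range
    rwa [Nat.card_zmod] at this
  have hfib : ∀ x, ((Finset.univ : Finset (Fin e → ZMod m)).filter fun y => ∑ k, x k * y k = 0).card
      = Nat.card (f x).ker := by
    intro x
    exact (Nat.subtype_card _ (by intro y; simp [f, AddMonoidHom.mem_ker])).symm
  have h1 : ((Finset.univ : Finset ((Fin e → ZMod m) × (Fin e → ZMod m))).filter
      fun z => ∑ k, z.1 k * z.2 k = 0).card = ∑ x, Nat.card (f x).ker := by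
    rw [Finset.card_eq_sum_card_fiberwise (f := Prod.fst) (t := Finset.univ) (by simp)]
    refine Finset.sum_congr rfl fun x _ => ?_
    rw [← hfib x]
    apply Finset.card_bij (fun z _ => z.2)
    · rintro ⟨a, b⟩ h; simp at h ⊢; rw [← h.2]; exact h.1
    · rintro ⟨a, b⟩ h ⟨a', b'⟩ h' h3; simp at h h' h3 ⊢; exact ⟨h.2.trans h'.2.symm, h3⟩
    · intro b hb; exact ⟨(x, b), by simpa using hb, rfl⟩
  rw [h1, ← Finset.sum_fiberwise_of_maps_to (g := hh) (t := m.divisors)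
    (fun x _ => Nat.mem_divisors.2 ⟨hdvd x, hm.ne'⟩), Finset.mul_sum]
  refine Finset.sum_le_sum fun h hhm => ?_
  have hpos : 0 < h := Nat.pos_of_mem_divisors hhm
  have hcnt : ((Finset.univ : Finset (Fin e → ZMod m)).filter fun x => hh x = h).card ≤ h ^ e := by
    have hsub : ((Finset.univ : Finset (Fin e → ZMod m)).filter fun x => hh x = h) ⊆
        Fintype.piFinset fun _ : Fin e => (Finset.univ : Finset (ZMod m)).filter fun a => h • a = 0 := by
      intro x hx
      simp only [Finset.mem_filter, Finset.mem_univ, true_and] at hx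
      simp only [Fintype.mem_piFinset, Finset.mem_filter, Finset.mem_univ, true_and]
      intro k
      have hmem : x k ∈ (f x).range := ⟨Pi.single k 1, by
        simp [f, Pi.single_apply]⟩
      have : Nat.card (f x).range • (⟨x k, hmem⟩ : (f x).range) = 0 := card_nsmul_eq_zero'
      have h3 := congrArg Subtype.val this
      rw [← hx]
      simpa [hh] using h3
    refine (Finset.card_le_card hsub).trans ?_
    rw [Fintype.card_piFinset]
    simp only [Finset.prod_const, Finset.card_univ, Fintype.card_fin]
    exact Nat.pow_le_pow_left (IsAddCyclic.card_nsmul_eq_zero_le hpos) _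
  by_cases hne : ∃ x, hh x = h
  · obtain ⟨x0, hx0⟩ := hne
    have hall : ∀ x ∈ ((Finset.univ : Finset (Fin e → ZMod m)).filter fun x => hh x = h),
        Nat.card (f x).ker ≤ Nat.card (f x0).ker := by
      intro x hx
      simp only [Finset.mem_filter, Finset.mem_univ, true_and] at hx
      have e1 := hker x
      have e2 := hker x0
      rw [hx] at e1
      rw [hx0] at e2
      exact le_of_eq (Nat.eq_of_mul_eq_mul_right hpos (e1.trans e2.symm))
    refine (Finset.sum_le_card_nsmul _ _ _ hall).trans ?_
    rw [smul_eq_mul]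
    calc _ ≤ h ^ e * Nat.card (f x0).ker := Nat.mul_le_mul_right _ hcnt
      _ = h ^ (e - 1) * (Nat.card (f x0).ker * hh x0) := by
          obtain ⟨e', rfl⟩ : ∃ e', e = e' + 1 := ⟨e - 1, by omega⟩
          rw [hx0]; simp [pow_succ]; ring
      _ = m ^ e * h ^ (e - 1) := by rw [hker, mul_comm]
  · push Not at hne
    rw [Finset.filter_false_of_mem (fun x _ => hne x)]
    simp

theorem divisor_sum (R e : ℕ) (he : 2 ≤ e) :
    ∑ m ∈ Finset.Ioc 0 R, ∑ h ∈ m.divisors, h ^ (e - 1) ≤ R ^ e := by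
  have h1 : ∑ m ∈ Finset.Ioc 0 R, ∑ h ∈ m.divisors, h ^ (e - 1) =
      ∑ h ∈ Finset.Ioc 0 R, ∑ m ∈ (Finset.Ioc 0 R).filter (h ∣ ·), h ^ (e - 1) := by
    apply Finset.sum_comm'
    intro m h
    simp only [Finset.mem_Ioc, Nat.mem_divisors, Finset.mem_filter]
    constructor
    · rintro ⟨⟨a, b⟩, c, d⟩
      exact ⟨⟨⟨a, b⟩, c⟩, Nat.pos_of_dvd_of_pos c a, (Nat.le_of_dvd a c).trans b⟩
    · rintro ⟨⟨⟨a, b⟩, c⟩, d⟩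
      exact ⟨⟨a, b⟩, c, by omega⟩
  rw [h1]
  obtain ⟨e', rfl⟩ : ∃ e', e = e' + 2 := ⟨e - 2, by omega⟩
  have h2 : ∀ h ∈ Finset.Ioc 0 R, ∑ m ∈ (Finset.Ioc 0 R).filter (h ∣ ·), h ^ (e' + 2 - 1) ≤ R * R ^ e' := by
    intro h hh
    rw [Finset.mem_Ioc] at hh
    rw [Finset.sum_const, Nat.Ioc_filter_dvd_card_eq_div, smul_eq_mul]
    calc R / h * h ^ (e' + 2 - 1) = (R / h * h) * h ^ e' := by
          rw [show e' + 2 - 1 = e' + 1 by omega, pow_succ]; ring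
      _ ≤ R * R ^ e' := Nat.mul_le_mul (Nat.div_mul_le_self _ _) (Nat.pow_le_pow_left hh.2 _)
  refine (Finset.sum_le_card_nsmul _ _ _ h2).trans ?_
  simp [pow_succ]
  apply le_of_eq; ring

end PartB1

section PartB2

open Finset

theorem box_residue (m R e : ℕ) (hm : 0 < m) (c : Fin e → ZMod m) :
    ((Fintype.piFinset fun _ : Fin e => Finset.Icc (-(R : ℤ)) R).filter
      fun u => (fun k => (u k : ZMod m)) = c).card ≤ (2 * R / m + 1) ^ e := by
  classical
  have hsub : ((Fintype.piFinset fun _ : Fin e => Finset.Icc (-(R : ℤ)) R).filter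
      fun u => (fun k => (u k : ZMod m)) = c) ⊆
      Fintype.piFinset fun k : Fin e => (Finset.Icc (-(R : ℤ)) R).filter fun x : ℤ => (x : ZMod m) = c k := by
    intro u hu
    simp only [Finset.mem_filter, Fintype.mem_piFinset] at hu ⊢
    exact fun k => ⟨hu.1 k, congrFun hu.2 k⟩
  refine (Finset.card_le_card hsub).trans ?_
  rw [Fintype.card_piFinset]
  refine (Finset.prod_le_pow_card _ _ (2 * R / m + 1) fun k _ => residue_count m R hm (c k)).trans ?_
  simp

theorem T_count (m R e : ℕ) (hm : 0 < m) (hmR : m ≤ R) (he : 1 ≤ e) :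
    (((Fintype.piFinset fun _ : Fin e => Finset.Icc (-(m : ℤ)) m) ×ˢ
      (Fintype.piFinset fun _ : Fin e => Finset.Icc (-(R : ℤ)) R)).filter
      fun z => (m : ℤ) ∣ ∑ k, z.1 k * z.2 k).card ≤
      3 ^ e * (3 * R) ^ e * ∑ h ∈ m.divisors, h ^ (e - 1) := by
  classical
  haveI : NeZero m := ⟨hm.ne'⟩
  have h1 := Finset.card_le_mul_card_image_of_maps_to
    (s := ((Fintype.piFinset fun _ : Fin e => Finset.Icc (-(m : ℤ)) m) ×ˢ
      (Fintype.piFinset fun _ : Fin e => Finset.Icc (-(R : ℤ)) R)).filter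
      fun z => (m : ℤ) ∣ ∑ k, z.1 k * z.2 k)
    (t := (Finset.univ : Finset ((Fin e → ZMod m) × (Fin e → ZMod m))).filter
      fun z => ∑ k, z.1 k * z.2 k = 0)
    (f := fun z => ((fun k => (z.1 k : ZMod m)), (fun k => (z.2 k : ZMod m))))
    (by
      intro z hz
      simp only [Finset.mem_filter, Finset.mem_univ, true_and] at hz ⊢
      have := (ZMod.intCast_zmod_eq_zero_iff_dvd _ m).2 hz.2
      push_cast at this
      exact this) (3 ^ e * (2 * R / m + 1) ^ e)
    (by
      rintro ⟨c1, c2⟩ -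
      have hsub : ((((Fintype.piFinset fun _ : Fin e => Finset.Icc (-(m : ℤ)) m) ×ˢ
        (Fintype.piFinset fun _ : Fin e => Finset.Icc (-(R : ℤ)) R)).filter
        fun z => (m : ℤ) ∣ ∑ k, z.1 k * z.2 k).filter fun z => ((fun k => (z.1 k : ZMod m)), (fun k => (z.2 k : ZMod m))) = (c1, c2)) ⊆
        ((Fintype.piFinset fun _ : Fin e => Finset.Icc (-(m : ℤ)) m).filter
          fun u => (fun k => (u k : ZMod m)) = c1) ×ˢ
        ((Fintype.piFinset fun _ : Fin e => Finset.Icc (-(R : ℤ)) R).filter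
          fun u => (fun k => (u k : ZMod m)) = c2) := by
        intro z hz
        simp only [Finset.mem_filter, Finset.mem_product, Prod.mk.injEq] at hz ⊢
        exact ⟨⟨hz.1.1.1, hz.2.1⟩, hz.1.1.2, hz.2.2⟩
      refine (Finset.card_le_card hsub).trans ?_
      rw [Finset.card_product]
      refine Nat.mul_le_mul ?_ (box_residue m R e hm c2)
      have := box_residue m m e hm c1
      rwa [Nat.mul_div_cancel _ hm] at this)
  refine h1.trans ?_
  refine (Nat.mul_le_mul_left _ (zmod_pairs m e hm he)).trans ?_
  rw [← mul_assoc]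
  refine Nat.mul_le_mul_right _ ?_
  rw [mul_assoc, ← mul_pow]
  refine Nat.mul_le_mul_left _ (Nat.pow_le_pow_left ?_ _)
  have := Nat.div_mul_le_self (2 * R) m
  rw [add_mul]
  omega

theorem orth_pairs (e : ℕ) (he : 2 ≤ e) : ∃ C : ℕ, ∀ R : ℕ,
    (((Fintype.piFinset fun _ : Fin (e + 1) => Finset.Icc (-(R : ℤ)) R) ×ˢ
      (Fintype.piFinset fun _ : Fin (e + 1) => Finset.Icc (-(R : ℤ)) R)).filter
      fun z => z.1 ≠ 0 ∧ ∑ k, z.1 k * z.2 k = 0).card ≤ C * R ^ (2 * e) := by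
  classical
  refine ⟨(e + 1) * (2 * (3 ^ e * 3 ^ e)), fun R => ?_⟩
  set P := ((Fintype.piFinset fun _ : Fin (e + 1) => Finset.Icc (-(R : ℤ)) R) ×ˢ
      (Fintype.piFinset fun _ : Fin (e + 1) => Finset.Icc (-(R : ℤ)) R)).filter
      fun z => z.1 ≠ 0 ∧ ∑ k, z.1 k * z.2 k = 0 with hP
  let Pi : Fin (e + 1) → ℕ → Finset ((Fin (e + 1) → ℤ) × (Fin (e + 1) → ℤ)) := fun i m =>
    P.filter fun z => |z.1 i| = m ∧ ∀ k, |z.1 k| ≤ m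
  have hcov : P ⊆ Finset.univ.biUnion fun i => (Finset.Ioc 0 R).biUnion fun m => Pi i m := by
    intro z hz
    have hz0 := hz
    rw [hP] at hz0
    simp only [Finset.mem_filter, Finset.mem_product, Fintype.mem_piFinset, Finset.mem_Icc] at hz0
    obtain ⟨i, -, hi⟩ := Finset.exists_max_image Finset.univ (fun k => |z.1 k|) ⟨0, Finset.mem_univ _⟩
    simp only [Finset.mem_biUnion, Finset.mem_univ, true_and, Finset.mem_Ioc]
    refine ⟨i, (z.1 i).natAbs, ⟨?_, ?_⟩, ?_⟩
    · rw [Int.natAbs_pos]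
      intro h0
      apply hz0.2.1
      funext k
      have := hi k (Finset.mem_univ k)
      rw [h0] at this
      simpa using this
    · have := hz0.1.1 i; omega
    · simp only [Pi, Finset.mem_filter]
      refine ⟨hz, (Int.natCast_natAbs _).symm, fun k => ?_⟩
      rw [Int.natCast_natAbs]
      exact hi k (Finset.mem_univ k)
  have hPi : ∀ i, ∀ m ∈ Finset.Ioc 0 R, (Pi i m).card ≤
      2 * (3 ^ e * (3 * R) ^ e * ∑ h ∈ m.divisors, h ^ (e - 1)) := by
    intro i m hm
    rw [Finset.mem_Ioc] at hm
    refine le_trans ?_ (Nat.mul_le_mul (Finset.card_le_two (a := (m : ℤ)) (b := -(m : ℤ)))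
      (T_count m R e hm.1 hm.2 (by omega)))
    rw [← Finset.card_product]
    apply Finset.card_le_card_of_injOn
      (fun z => (z.1 i, ((fun k => z.1 (i.succAbove k)), (fun k => z.2 (i.succAbove k)))))
    · intro z hz
      simp only [Pi, hP, Finset.coe_filter, Finset.mem_filter, Finset.mem_product, Fintype.mem_piFinset, Finset.mem_Icc, Set.mem_setOf_eq] at hz
      obtain ⟨⟨⟨hz1, hz2⟩, hz3, hz4⟩, hz5, hz6⟩ := hz
      simp only [Finset.coe_product, Set.mem_prod, Finset.mem_coe, Finset.mem_filter, Finset.mem_product, Fintype.mem_piFinset, Finset.mem_Icc, Finset.mem_insert, Finset.mem_singleton]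
      refine ⟨?_, ⟨fun k => abs_le.1 (hz6 _), fun k => hz2 _⟩, ?_⟩
      · rcases abs_choice (z.1 i) with h | h <;> omega
      · rw [Fin.sum_univ_succAbove _ i] at hz4
        have h1 : (m : ℤ) ∣ z.1 i := by rw [← hz5, abs_dvd]
        have h2 := (Dvd.dvd.mul_right h1 (z.2 i))
        exact (dvd_add_right h2).1 (hz4 ▸ dvd_zero _)
    · intro z hz z' hz' h
      simp only [Pi, hP, Finset.coe_filter, Finset.mem_filter, Set.mem_setOf_eq] at hz hz'
      simp only [Prod.mk.injEq] at h
      obtain ⟨h1, h2, h3⟩ := h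
      have hz4 := hz.1.2.2
      have hz4' := hz'.1.2.2
      rw [Fin.sum_univ_succAbove _ i] at hz4 hz4'
      have e1 : z.1 = z'.1 := by
        funext k
        rcases Fin.eq_self_or_eq_succAbove i k with rfl | ⟨k, rfl⟩
        · exact h1
        · exact congrFun h2 k
      have hne : z.1 i ≠ 0 := by
        intro h0
        have := hz.2.1
        rw [h0] at this
        simp at this
        omega
      have h4 : z.2 i = z'.2 i := by
        have h5 : ∑ k, z.1 (i.succAbove k) * z.2 (i.succAbove k) = ∑ k, z'.1 (i.succAbove k) * z'.2 (i.succAbove k) := by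
          refine Finset.sum_congr rfl fun k _ => ?_
          rw [e1, congrFun h3 k]
        rw [h5] at hz4
        rw [← e1] at hz4'
        rw [← e1] at hz4
        have : z.1 i * z.2 i = z.1 i * z'.2 i := by linarith
        exact mul_left_cancel₀ hne this
      refine Prod.ext e1 (funext fun k => ?_)
      rcases Fin.eq_self_or_eq_succAbove i k with rfl | ⟨k, rfl⟩
      · exact h4
      · exact congrFun h3 k
  refine (Finset.card_le_card hcov).trans ?_
  refine Finset.card_biUnion_le.trans ?_
  have hs : ∀ i ∈ (Finset.univ : Finset (Fin (e + 1))),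
      ((Finset.Ioc 0 R).biUnion fun m => Pi i m).card ≤ 2 * (3 ^ e * 3 ^ e) * R ^ (2 * e) := by
    intro i _
    refine Finset.card_biUnion_le.trans ?_
    refine (Finset.sum_le_sum (hPi i)).trans ?_
    rw [← Finset.mul_sum, ← Finset.mul_sum]
    refine (Nat.mul_le_mul_left _ (Nat.mul_le_mul_left _ (divisor_sum R e he))).trans ?_
    rw [mul_pow, two_mul e, pow_add]
    apply le_of_eq; ring
  refine (Finset.sum_le_card_nsmul _ _ _ hs).trans ?_
  rw [Finset.card_univ, Fintype.card_fin, smul_eq_mul, ← mul_assoc]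

end PartB2

section PartC1

open MvPolynomial

theorem eval_qPolyInt (M d : ℕ) (K : Type*) [CommRing K]
    (β : Matrix (Fin M) (Fin M) ℤ) (z1 v : Fin d → K) (j : Fin (M - 2)) (w : Fin (M - 2) × Fin d → K) :
    eval w (qPolyInt M d K β z1 v j) = ∑ k : Fin d,
    w (j, k) *
      (((β ⟨j.1 + 1, by have := j.2; omega⟩ ⟨0, by have := j.2; omega⟩ : ℤ) * z1 k +
            (β ⟨j.1 + 1, by have := j.2; omega⟩ ⟨M - 1, by have := j.2; omega⟩ : ℤ) * v k) +
        ∑ i : Fin (M - 2),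
          (((β ⟨j.1 + 1, by have := j.2; omega⟩ ⟨i.1 + 1, by have := i.2; omega⟩ -
                  β ⟨j.1 + 1, by have := j.2; omega⟩ ⟨M - 1, by have := j.2; omega⟩ *
                    β ⟨0, by have := j.2; omega⟩ ⟨i.1 + 1, by have := i.2; omega⟩ : ℤ) : K)) *
            w (i, k)) := by
  unfold qPolyInt
  simp only [map_sum, map_mul, map_add, eval_X, eval_C, map_intCast]

theorem deg_qPolyInt (M d : ℕ) (K : Type*) [CommRing K] [Nontrivial K]
    (β : Matrix (Fin M) (Fin M) ℤ) (z1 v : Fin d → K) (j : Fin (M - 2)) :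
    (qPolyInt M d K β z1 v j).totalDegree ≤ 2 := by
  unfold qPolyInt
  refine totalDegree_finsetSum_le fun k _ => ?_
  refine (totalDegree_mul _ _).trans ?_
  have h1 : (X (j, k) : MvPolynomial (Fin (M - 2) × Fin d) K).totalDegree ≤ 1 := (totalDegree_X _).le
  refine add_le_add h1 (d := 1) ?_
  refine (totalDegree_add _ _).trans (max_le ?_ ?_)
  · rw [totalDegree_C]; omega
  · refine totalDegree_finsetSum_le fun i _ => ?_
    refine (totalDegree_mul _ _).trans ?_
    rw [totalDegree_C, zero_add]
    exact (totalDegree_X _).le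

theorem Q_count (M d : ℕ) (hM : 2 ≤ M) (hd : 1 ≤ d) : ∃ B : ℕ, ∀ (p : ℕ) [Fact p.Prime]
    (β : Matrix (Fin M) (Fin M) ℤ), MainConj M d (AlgebraicClosure (ZMod p)) β →
    ∀ z1 v : Fin d → ZMod p, (∑ k : Fin d, z1 k * v k) = 0 → z1 ≠ 0 → v ≠ 0 →
    ∀ Y : Finset (Fin (M - 2) × Fin d → ZMod p),
      (∀ w ∈ Y, ∀ j, eval w (qPolyInt M d (ZMod p) β z1 v j) = 0) →
      Y.card ≤ B * p ^ ((M - 2) * (d - 1)) := by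
  classical
  obtain ⟨B, hB⟩ := variety_count ((M - 2) * d) ((M - 2) * (d - 1))
  refine ⟨B, ?_⟩
  intro p hp β hMC z1 v h0 h1 h2 Y hY
  let K := AlgebraicClosure (ZMod p)
  let φ : ZMod p →+* K := algebraMap (ZMod p) K
  have hφ : Function.Injective φ := φ.injective
  have hdim := hMC (fun k => φ (z1 k)) (fun k => φ (v k))
    (by simp only [← map_mul, ← map_sum, h0, map_zero])
    (by
      intro h; apply h1; funext k
      have := congrFun h k
      exact hφ (by simpa using this))
    (by
      intro h; apply h2; funext k
      have := congrFun h k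
      exact hφ (by simpa using this))
  have key := hB (M - 2) (by
      obtain ⟨d', rfl⟩ : ∃ d', d = d' + 1 := ⟨d - 1, by omega⟩
      simp [mul_add]) K (Fin (M - 2) × Fin d) (by simp) (by
      intro h; exact Nat.pos_of_mul_pos_right h)
      (fun j => qPolyInt M d K β (fun k => φ (z1 k)) (fun k => φ (v k)) j)
      (fun j => deg_qPolyInt _ _ _ _ _ _ _) hdim.le (Finset.univ.image φ)
      (Y.image fun w i => φ (w i)) (by
        intro x hx i
        obtain ⟨w, hw, rfl⟩ := Finset.mem_image.1 hx
        exact Finset.mem_image_of_mem _ (Finset.mem_univ _)) (by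
        intro x hx j
        obtain ⟨w, hw, rfl⟩ := Finset.mem_image.1 hx
        have := congrArg φ (hY w hw j)
        rw [map_zero, eval_qPolyInt] at this
        rw [eval_qPolyInt, ← this]
        simp only [map_sum, map_mul, map_add, map_intCast]) ⟨φ 0, by simp⟩
  rw [Finset.card_image_of_injective _ hφ, Finset.card_univ, ZMod.card,
    Finset.card_image_of_injective] at key
  · exact key
  · intro w w' h
    funext i
    exact hφ (congrFun h i)

end PartC1

section PartC2

open MvPolynomial

/-- The hypothesis of the main theorem. -/
def MCall (d N : ℕ) : Prop :=
  ∀ (p : ℕ) [Fact p.Prime], ∀ (M : ℕ) (_h2 : 2 ≤ M) (_hMN : M ≤ N)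
        (β : Matrix (Fin M) (Fin M) ℤ),
        (∀ i j, β j i = -β i j) →
        (∀ i j, β i j = -1 ∨ β i j = 0 ∨ β i j = 1) →
        (∀ i, ∃ j, β i j ≠ 0) →
        β ⟨0, by omega⟩ ⟨M - 1, by omega⟩ = 1 →
        MatIrreducible β →
        MainConj M d (AlgebraicClosure (ZMod p)) β

/-- The class (rock, paper, scissors) of an index. -/
def rpsClass (d : ℕ) (n : ℕ) : Fin 3 := if n = 0 then 0 else if n = d + 1 then 2 else 1

/-- The rock-paper-scissors matrix on three classes. -/
def rps (a b : Fin 3) : ℤ := if b = a + 1 then 1 else if a = b + 1 then -1 else 0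

theorem rps_skew : ∀ a b, rps b a = - rps a b := by decide
theorem rps_vals : ∀ a b, rps a b = -1 ∨ rps a b = 0 ∨ rps a b = 1 := by decide
theorem rps_ne : ∀ a b, a ≠ b → rps a b ≠ 0 := by decide
theorem rps_other : ∀ a : Fin 3, a = 0 ∨ a ≠ 0 := by decide

theorem MC_bound (d N : ℕ) (hd : 2 ≤ d) (h : MCall d N) : N < d + 3 := by
  classical
  by_contra hN
  push Not at hN
  obtain ⟨B, hB⟩ := Q_count (d + 3) d (by omega) (by omega)
  obtain ⟨p, hpB, hp⟩ := Nat.exists_infinite_primes (B + 1)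
  haveI : Fact p.Prime := ⟨hp⟩
  let β : Matrix (Fin (d + 3)) (Fin (d + 3)) ℤ := fun i j => rps (rpsClass d i.1) (rpsClass d j.1)
  have cl0 : rpsClass d 0 = 0 := by simp [rpsClass]
  have clC : rpsClass d (d + 1) = 2 := by simp [rpsClass]
  have clL : rpsClass d (d + 2) = 1 := by simp [rpsClass]
  have clB : ∀ n, n < d → rpsClass d (n + 1) = 1 := by
    intro n hn; simp [rpsClass]; omega
  have hsurj : ∀ a : Fin 3, ∃ k : Fin (d + 3), rpsClass d k.1 ≠ a := by
    intro a
    by_cases ha : a = 0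
    · subst ha
      exact ⟨⟨d + 1, by omega⟩, by simp only [clC]; decide⟩
    · exact ⟨⟨0, by omega⟩, by simp only [cl0]; exact fun h => ha h.symm⟩
  have hMC := h p (d + 3) (by omega) hN β (fun i j => rps_skew _ _) (fun i j => rps_vals _ _)
    (by
      intro i
      obtain ⟨k, hk⟩ := hsurj (rpsClass d i.1)
      exact ⟨k, rps_ne _ _ hk.symm⟩)
    (by
      change rps (rpsClass d 0) (rpsClass d (d + 2)) = 1
      rw [cl0, clL]; decide)
    (by
      rintro I ⟨i, hi⟩ ⟨j, hj⟩
      by_cases hij : rpsClass d i.1 = rpsClass d j.1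
      · obtain ⟨k, hk⟩ := hsurj (rpsClass d i.1)
        by_cases hkI : k ∈ I
        · exact ⟨k, hkI, j, hj, rps_ne _ _ (by rw [← hij]; exact hk)⟩
        · exact ⟨i, hi, k, hkI, rps_ne _ _ hk.symm⟩
      · exact ⟨i, hi, j, hj, rps_ne _ _ hij⟩)
  let z1 : Fin d → ZMod p := Pi.single ⟨0, by omega⟩ 1
  let v : Fin d → ZMod p := Pi.single ⟨1, by omega⟩ 1
  have h01 : ∑ k : Fin d, z1 k * v k = 0 := by
    apply Finset.sum_eq_zero
    intro k _
    simp only [z1, v, Pi.single_apply]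
    split_ifs with h1 h2
    · rw [h1] at h2; simp at h2
    all_goals simp
  have hz1 : z1 ≠ 0 := by
    intro h; have := congrFun h ⟨0, by omega⟩; simp [z1] at this
  have hv : v ≠ 0 := by
    intro h; have := congrFun h ⟨1, by omega⟩; simp [v] at this
  let g : (Fin d × Fin d → ZMod p) → (Fin (d + 3 - 2) × Fin d → ZMod p) := fun u x =>
    if hx : x.1.1 < d then u (⟨x.1.1, hx⟩, x.2) else z1 x.2
  have hg : Function.Injective g := by
    intro u u' h
    funext x
    have := congrFun h (⟨x.1.1, by have := x.1.2; omega⟩, x.2)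
    simpa [g] using this
  have key := hB p β hMC z1 v h01 hz1 hv (Finset.univ.image g) (by
    intro w hw j
    obtain ⟨u, -, rfl⟩ := Finset.mem_image.1 hw
    rw [eval_qPolyInt]
    let c : Fin (d + 3 - 2) := ⟨d, by omega⟩
    have hgc : ∀ k, g u (c, k) = z1 k := by intro k; simp [g, c]
    by_cases hj : j.1 < d
    · apply Finset.sum_eq_zero
      intro k _
      convert mul_zero _
      rw [Finset.sum_eq_single c]
      · rw [hgc]
        simp only [β, c, cl0, clC, clB _ hj, show d + 3 - 1 = d + 2 by omega, clL]
        simp [show rps 1 0 = -1 by decide, show rps 1 1 = 0 by decide, show rps 1 2 = 1 by decide]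
      · intro i _ hi
        have hi' : i.1 < d := by
          have := i.2
          have : i.1 ≠ d := fun h => hi (Fin.ext h)
          omega
        simp only [β, clB _ hi', clB _ hj, show d + 3 - 1 = d + 2 by omega, clL]
        simp [show rps 1 1 = 0 by decide]
      · intro h; exact absurd (Finset.mem_univ _) h
    · have hjd : j.1 = d := by have := j.2; omega
      have hjc : j = c := Fin.ext hjd
      have : ∀ k, g u (j, k) = z1 k := by rw [hjc]; exact hgc
      rw [← neg_zero, ← h01, ← Finset.sum_neg_distrib]
      refine Finset.sum_congr rfl fun k _ => ?_
      rw [Finset.sum_eq_single c, hgc, this]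
      · simp only [β, c, hjd, cl0, clC, show d + 3 - 1 = d + 2 by omega, clL]
        simp [show rps 2 0 = 1 by decide, show rps 2 1 = -1 by decide, show rps 2 2 = 0 by decide,
          show rps 0 2 = -1 by decide]
      · intro i _ hi
        have hi' : i.1 < d := by
          have := i.2
          have : i.1 ≠ d := fun h => hi (Fin.ext h)
          omega
        simp only [β, hjd, clB _ hi', clC, cl0, show d + 3 - 1 = d + 2 by omega, clL]
        simp [show rps 2 1 = -1 by decide, show rps 0 1 = 1 by decide]
      · intro h; exact absurd (Finset.mem_univ _) h)
  rw [Finset.card_image_of_injective _ hg, Finset.card_univ, Fintype.card_fun, ZMod.card,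
    Fintype.card_prod, Fintype.card_fin] at key
  have e1 : d * d = (d + 3 - 2) * (d - 1) + 1 := by
    obtain ⟨d', rfl⟩ : ∃ d', d = d' + 1 := ⟨d - 1, by omega⟩
    simp only [show d' + 1 + 3 - 2 = d' + 2 by omega, Nat.add_sub_cancel]
    ring
  rw [e1, pow_succ, mul_comm] at key
  have := Nat.le_of_mul_le_mul_right key (pow_pos hp.pos _)
  omega

end PartC2

section PartC3

open MvPolynomial

/-- Integer points of size at most `R` on the resonance variety of `α`. -/
structure InX {ι : Type} [Fintype ι] {d : ℕ} (α : Matrix ι ι ℤ) (R : ℕ) (a : ι → Fin d → ℤ) :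
    Prop where
  bd : ∀ j k, |a j k| ≤ R
  ne : ∀ j, a j ≠ 0
  om : ∀ j, ∑ k, a j k * ∑ i, α j i * a i k = 0

theorem sum_split {A : Type*} [AddCommMonoid A] (M : ℕ) (hM : 2 ≤ M) (f : Fin M → A) :
    ∑ i, f i = f ⟨0, by omega⟩ + (∑ i : Fin (M - 2), f ⟨i.1 + 1, by have := i.2; omega⟩) +
      f ⟨M - 1, by omega⟩ := by
  obtain ⟨m, rfl⟩ : ∃ m, M = m + 2 := ⟨M - 2, by omega⟩
  rw [Fin.sum_univ_succ, Fin.sum_univ_castSucc, ← add_assoc]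
  rfl

theorem small_cast (p : ℕ) (a : ℤ) (h : |a| < p) (h0 : (a : ZMod p) = 0) : a = 0 :=
  Int.eq_zero_of_abs_lt_dvd ((ZMod.intCast_zmod_eq_zero_iff_dvd _ p).1 h0) h

theorem q_eval_int (M d : ℕ) (hM : 2 ≤ M) (β : Matrix (Fin M) (Fin M) ℤ)
    (h00 : β ⟨0, by omega⟩ ⟨0, by omega⟩ = 0) (h0L : β ⟨0, by omega⟩ ⟨M - 1, by omega⟩ = 1)
    (a : Fin M → Fin d → ℤ) (j : Fin (M - 2)) :
    eval (fun x : Fin (M - 2) × Fin d => a ⟨x.1.1 + 1, by have := x.1.2; omega⟩ x.2)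
      (qPolyInt M d ℤ β (a ⟨0, by omega⟩) (fun k => ∑ i, β ⟨0, by omega⟩ i * a i k) j) =
      ∑ k, a ⟨j.1 + 1, by have := j.2; omega⟩ k *
        ∑ i, β ⟨j.1 + 1, by have := j.2; omega⟩ i * a i k := by
  rw [eval_qPolyInt]
  refine Finset.sum_congr rfl fun k _ => ?_
  congr 1
  rw [sum_split M hM (fun i => β ⟨0, by omega⟩ i * a i k),
    sum_split M hM (fun i => β ⟨j.1 + 1, by have := j.2; omega⟩ i * a i k)]
  simp only [h00, h0L, Int.cast_id, sub_mul, Finset.sum_sub_distrib, mul_add, Finset.mul_sum, mul_assoc]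
  ring

theorem q_eval_cast (M d p : ℕ) (β : Matrix (Fin M) (Fin M) ℤ)
    (x y : Fin d → ℤ) (w : Fin (M - 2) × Fin d → ℤ) (j : Fin (M - 2)) :
    eval (fun i => (w i : ZMod p)) (qPolyInt M d (ZMod p) β (fun k => (x k : ZMod p))
      (fun k => (y k : ZMod p)) j) = ((eval w (qPolyInt M d ℤ β x y j) : ℤ) : ZMod p) := by
  rw [eval_qPolyInt, eval_qPolyInt]
  push_cast
  rfl

theorem core_count (M e N : ℕ) (hM : 2 ≤ M) (hMN : M ≤ N) (he : 2 ≤ e) (hMC : MCall (e + 1) N) :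
    ∃ C : ℕ, ∀ β : Matrix (Fin M) (Fin M) ℤ, (∀ i j, β j i = -β i j) →
        (∀ i j, β i j = -1 ∨ β i j = 0 ∨ β i j = 1) →
        (∀ i, ∃ j, β i j ≠ 0) →
        β ⟨0, by omega⟩ ⟨M - 1, by omega⟩ = 1 →
        MatIrreducible β → ∀ R : ℕ, 1 ≤ R → ∀ Y : Finset (Fin M → Fin (e + 1) → ℤ),
        (∀ a ∈ Y, InX β R a ∧ (fun k => ∑ i, β ⟨0, by omega⟩ i * a i k) ≠ 0) →
        Y.card ≤ C * R ^ (M * e) := by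
  classical
  obtain ⟨C1, hC1⟩ := orth_pairs e he
  obtain ⟨B, hB⟩ := Q_count M (e + 1) hM (by omega)
  refine ⟨B * (4 * M) ^ ((M - 2) * e) * (C1 * M ^ (2 * e)), ?_⟩
  intro β hskew hvals hrow h0L hirr R hR Y hY
  have h00 : β ⟨0, by omega⟩ ⟨0, by omega⟩ = 0 := by
    have := hskew ⟨0, by omega⟩ ⟨0, by omega⟩; omega
  let V : (Fin M → Fin (e + 1) → ℤ) → Fin (e + 1) → ℤ := fun a k => ∑ i, β ⟨0, by omega⟩ i * a i k
  have hV : ∀ a, InX β R a → ∀ k, |V a k| ≤ (M * R : ℕ) := by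
    intro a ha k
    refine (Finset.abs_sum_le_sum_abs _ _).trans ?_
    have : ∀ i ∈ (Finset.univ : Finset (Fin M)), |β ⟨0, by omega⟩ i * a i k| ≤ (R : ℤ) := by
      intro i _
      rw [abs_mul]
      have h1 := ha.bd i k
      have h2 := abs_nonneg (a i k)
      rcases hvals ⟨0, by omega⟩ i with h | h | h <;> rw [h] <;> simp <;> omega
    refine (Finset.sum_le_card_nsmul _ _ _ this).trans ?_
    simp
  have hRM : R ≤ M * R := Nat.le_mul_of_pos_left _ (by omega)
  obtain ⟨p, hp, hp1, hp2⟩ := Nat.exists_prime_lt_and_le_two_mul (2 * (M * R)) (by positivity)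
  have : Fact p.Prime := ⟨hp⟩
  have h1 := Finset.card_le_mul_card_image_of_maps_to (s := Y)
    (t := ((Fintype.piFinset fun _ : Fin (e + 1) => Finset.Icc (-((M * R : ℕ) : ℤ)) (M * R : ℕ)) ×ˢ
      (Fintype.piFinset fun _ : Fin (e + 1) => Finset.Icc (-((M * R : ℕ) : ℤ)) (M * R : ℕ))).filter
      fun z => z.1 ≠ 0 ∧ ∑ k, z.1 k * z.2 k = 0)
    (f := fun a => (a ⟨0, by omega⟩, V a))
    (by
      intro a ha
      obtain ⟨ha1, ha2⟩ := hY a ha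
      simp only [Finset.mem_filter, Finset.mem_product, Fintype.mem_piFinset, Finset.mem_Icc]
      refine ⟨⟨fun k => abs_le.1 ((ha1.bd _ k).trans (by exact_mod_cast hRM)),
        fun k => abs_le.1 (hV a ha1 k)⟩, ha1.ne _, ha1.om _⟩)
    (B * p ^ ((M - 2) * e)) (by
      rintro ⟨x, y⟩ -
      by_cases hne : ∃ a0 ∈ Y, (a0 ⟨0, by omega⟩, V a0) = (x, y)
      swap
      · push Not at hne
        rw [Finset.filter_false_of_mem (fun a ha => hne a ha)]
        simp
      obtain ⟨a0, ha0, hxy⟩ := hne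
      simp only [Prod.mk.injEq] at hxy
      obtain ⟨hx, hy⟩ := hxy
      obtain ⟨hin, hv0⟩ := hY a0 ha0
      have hxb : ∀ k, |x k| < p := fun k => by
        have := hin.bd ⟨0, by omega⟩ k
        rw [hx] at this
        omega
      have hyb : ∀ k, |y k| < p := fun k => by
        have := hV a0 hin k
        rw [hy] at this
        omega
      have hx0 : x ≠ 0 := hx ▸ hin.ne _
      have hy0 : y ≠ 0 := hy ▸ hv0
      let ρ : (Fin M → Fin (e + 1) → ℤ) → (Fin (M - 2) × Fin (e + 1) → ZMod p) := fun a x =>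
        ((a ⟨x.1.1 + 1, by have := x.1.2; omega⟩ x.2 : ℤ) : ZMod p)
      have hinj : Set.InjOn ρ (Y.filter fun a => (a ⟨0, by omega⟩, V a) = (x, y)) := by
        intro a ha a' ha' h
        simp only [Finset.coe_filter, Set.mem_ofPred_eq, Prod.mk.injEq] at ha ha'
        obtain ⟨haY, hax, hay⟩ := ha
        obtain ⟨haY', hax', hay'⟩ := ha'
        have hmid : ∀ i : Fin (M - 2), a ⟨i.1 + 1, by have := i.2; omega⟩ = a' ⟨i.1 + 1, by have := i.2; omega⟩ := by
          intro i
          funext k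
          have h1 := congrFun h (i, k)
          simp only [ρ] at h1
          rw [← sub_eq_zero]
          apply small_cast p
          · have b1 := (hY a haY).1.bd ⟨i.1 + 1, by have := i.2; omega⟩ k
            have b2 := (hY a' haY').1.bd ⟨i.1 + 1, by have := i.2; omega⟩ k
            rw [abs_le] at b1 b2
            rw [abs_lt]
            constructor <;> omega
          · push_cast; rw [h1, sub_self]
        have h0 : a ⟨0, by omega⟩ = a' ⟨0, by omega⟩ := hax.trans hax'.symm
        have hL : a ⟨M - 1, by omega⟩ = a' ⟨M - 1, by omega⟩ := by
          funext k
          have h2 : V a k = V a' k := congrFun (hay.trans hay'.symm) k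
          simp only [V] at h2
          rw [sum_split M hM, sum_split M hM (fun i => β ⟨0, by omega⟩ i * a' i k)] at h2
          simp only [h0, hmid, h0L] at h2
          linarith
        funext i
        by_cases hi0 : i.1 = 0
        · have : i = ⟨0, by omega⟩ := Fin.ext hi0
          rw [this]; exact h0
        by_cases hiL : i.1 = M - 1
        · have : i = ⟨M - 1, by omega⟩ := Fin.ext hiL
          rw [this]; exact hL
        · have := hmid ⟨i.1 - 1, by have := i.2; omega⟩
          have hi : i = ⟨(i.1 - 1) + 1, by have := i.2; omega⟩ := Fin.ext (by simp; omega)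
          rw [hi]; exact this
      rw [← Finset.card_image_of_injOn hinj]
      refine hB p β (hMC p M hM hMN β hskew hvals hrow h0L hirr) (fun k => (x k : ZMod p))
        (fun k => (y k : ZMod p)) ?_ ?_ ?_ _ ?_
      · have := hin.om ⟨0, by omega⟩
        have h3 : ∑ k, x k * y k = 0 := by rw [← hx, ← hy]; exact this
        have h4 := congrArg (Int.cast : ℤ → ZMod p) h3
        push_cast at h4
        exact h4
      · intro h
        exact hx0 (funext fun k => small_cast p _ (hxb k) (congrFun h k))
      · intro h
        exact hy0 (funext fun k => small_cast p _ (hyb k) (congrFun h k))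
      · intro w hw j
        obtain ⟨a, ha, rfl⟩ := Finset.mem_image.1 hw
        simp only [Finset.mem_filter, Prod.mk.injEq] at ha
        obtain ⟨haY, hax, hay⟩ := ha
        have h5 := q_eval_int M (e + 1) hM β h00 h0L a j
        rw [(hY a haY).1.om] at h5
        have h6 := q_eval_cast M (e + 1) p β x y (fun x : Fin (M - 2) × Fin (e + 1) => a ⟨x.1.1 + 1, by have := x.1.2; omega⟩ x.2) j
        rw [← hax, ← hay] at h6
        simp only [V] at h6
        rw [h5, Int.cast_zero] at h6
        rw [← hax, ← hay]
        exact h6)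
  refine h1.trans ?_
  refine (Nat.mul_le_mul (Nat.mul_le_mul_left _ (Nat.pow_le_pow_left hp2 _)) (hC1 (M * R))).trans ?_
  apply le_of_eq
  have : M * e = (M - 2) * e + 2 * e := by rw [← add_mul]; congr 1; omega
  rw [this, pow_add, show 2 * (2 * (M * R)) = 4 * M * R by ring, mul_pow, mul_pow M R]
  ring

end PartC3

section PartC4

open MvPolynomial

theorem zero_case {ι : Type} [Fintype ι] (d : ℕ) (α : Matrix ι ι ℤ)
    (hskew : ∀ i j, α j i = -α i j) (j k : ι) (hjk : α j k ≠ 0) (R : ℕ)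
    (Y : Finset (ι → Fin d → ℤ)) (hY : ∀ a ∈ Y, InX α R a ∧ ∀ j k, ∑ i, α j i * a i k = 0) :
    Y.card ≤ (2 * R + 1) ^ ((Fintype.card ι - 2) * d) := by
  classical
  have hd0 : ∀ i, α i i = 0 := fun i => by have := hskew i i; omega
  have hne : j ≠ k := by rintro rfl; exact hjk (hd0 j)
  let T := {i : ι // i ∉ ({j, k} : Finset ι)}
  have hT : Fintype.card T = Fintype.card ι - 2 := by
    rw [Fintype.card_subtype_compl, Fintype.card_coe, Finset.card_pair hne]
  let bx : Finset (T → Fin d → ℤ) :=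
    Fintype.piFinset fun _ => Fintype.piFinset fun _ => Finset.Icc (-(R : ℤ)) R
  have hbx : bx.card = (2 * R + 1) ^ ((Fintype.card ι - 2) * d) := by
    simp only [bx, Fintype.card_piFinset, Finset.prod_const, Finset.card_univ, Fintype.card_fin, hT,
      Int.card_Icc]
    rw [← pow_mul, mul_comm d]
    congr 1
    omega
  rw [← hbx]
  apply Finset.card_le_card_of_injOn (fun a i => a i.1)
  · intro a ha
    simp only [bx, Finset.mem_coe, Fintype.mem_piFinset, Finset.mem_Icc]
    exact fun i l => abs_le.1 ((hY a ha).1.bd _ _)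
  · intro a ha a' ha' h
    have hoff : ∀ i, i ≠ j → i ≠ k → a i = a' i := fun i h1 h2 =>
      congrFun h (⟨i, by simp [h1, h2]⟩ : T)
    have h1 : ∀ l, ∑ i, α j i * (a i l - a' i l) = 0 := fun l => by
      simp only [mul_sub, Finset.sum_sub_distrib, (hY a ha).2, (hY a' ha').2, sub_self]
    have h2 : ∀ l, ∑ i, α k i * (a i l - a' i l) = 0 := fun l => by
      simp only [mul_sub, Finset.sum_sub_distrib, (hY a ha).2, (hY a' ha').2, sub_self]
    have hk : a k = a' k := by
      funext l
      have := h1 l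
      rw [Finset.sum_eq_single k] at this
      · rcases mul_eq_zero.1 this with h | h
        · exact absurd h hjk
        · omega
      · intro i _ hi
        by_cases hij : i = j
        · rw [hij, hd0, zero_mul]
        · rw [hoff i hij hi, sub_self, mul_zero]
      · intro h; exact absurd (Finset.mem_univ _) h
    have hj : a j = a' j := by
      funext l
      have := h2 l
      rw [Finset.sum_eq_single j] at this
      · rcases mul_eq_zero.1 this with h | h
        · rw [hskew j k] at h; omega
        · omega
      · intro i _ hi
        by_cases hij : i = k
        · rw [hij, hd0, zero_mul]
        · rw [hoff i hi hij, sub_self, mul_zero]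
      · intro h; exact absurd (Finset.mem_univ _) h
    funext i
    by_cases h1 : i = j
    · rw [h1]; exact hj
    by_cases h2 : i = k
    · rw [h2]; exact hk
    · exact hoff i h1 h2

theorem exists_reindex {ι : Type} [Fintype ι] (M : ℕ) (hM : 2 ≤ M) (hc : Fintype.card ι = M)
    (j k : ι) (hjk : j ≠ k) : ∃ ε : Fin M ≃ ι, ε ⟨0, by omega⟩ = j ∧ ε ⟨M - 1, by omega⟩ = k := by
  classical
  let ε0 : Fin M ≃ ι := (Fintype.equivFinOfCardEq hc).symm
  let ε1 := ε0.trans (Equiv.swap (ε0 ⟨0, by omega⟩) j)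
  have h1 : ε1 ⟨0, by omega⟩ = j := by simp [ε1]
  refine ⟨ε1.trans (Equiv.swap (ε1 ⟨M - 1, by omega⟩) k), ?_, ?_⟩
  · rw [Equiv.trans_apply, h1]
    apply Equiv.swap_apply_of_ne_of_ne _ hjk
    rw [← h1]
    intro h
    have := ε1.injective h
    simp at this
    omega
  · simp

theorem irred_count (M e N : ℕ) (hM : 2 ≤ M) (hMN : M ≤ N) (he : 2 ≤ e) (hMC : MCall (e + 1) N) :
    ∃ C : ℕ, ∀ (ι : Type) [Fintype ι], Fintype.card ι = M → ∀ α : Matrix ι ι ℤ,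
        (∀ i j, α j i = -α i j) →
        (∀ i j, α i j = -1 ∨ α i j = 0 ∨ α i j = 1) →
        (∀ i, ∃ j, α i j ≠ 0) →
        (∀ I : Set ι, I.Nonempty → Iᶜ.Nonempty → ∃ i ∈ I, ∃ j ∈ Iᶜ, α i j ≠ 0) →
        ∀ R : ℕ, 1 ≤ R → ∀ Y : Finset (ι → Fin (e + 1) → ℤ),
        (∀ a ∈ Y, InX α R a) → Y.card ≤ C * R ^ (M * e) := by
  classical
  obtain ⟨C, hC⟩ := core_count M e N hM hMN he hMC
  have hb := MC_bound (e + 1) N (by omega) hMC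
  refine ⟨3 ^ ((M - 2) * (e + 1)) + M * C, ?_⟩
  intro ι _ hc α hskew hvals hrow hirr R hR Y hY
  have hd0 : ∀ i, α i i = 0 := fun i => by have := hskew i i; omega
  let Y0 := Y.filter fun a => ∀ j k, ∑ i, α j i * a i k = 0
  let Yj : ι → Finset (ι → Fin (e + 1) → ℤ) := fun j => Y.filter fun a => (fun k => ∑ i, α j i * a i k) ≠ 0
  have hcov : Y ⊆ Y0 ∪ Finset.univ.biUnion Yj := by
    intro a ha
    rw [Finset.mem_union]
    by_cases h : ∀ j k, ∑ i, α j i * a i k = 0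
    · left; exact Finset.mem_filter.2 ⟨ha, h⟩
    · right
      push Not at h
      obtain ⟨j, k, hjk⟩ := h
      exact Finset.mem_biUnion.2 ⟨j, Finset.mem_univ _, Finset.mem_filter.2 ⟨ha, fun h => hjk (congrFun h k)⟩⟩
  have hY0 : Y0.card ≤ 3 ^ ((M - 2) * (e + 1)) * R ^ (M * e) := by
    have : Nonempty ι := by rw [← Fintype.card_pos_iff]; omega
    obtain ⟨j⟩ := this
    obtain ⟨k, hk⟩ := hrow j
    refine (zero_case (e + 1) α hskew j k hk R Y0 (by
      intro a ha
      obtain ⟨h1, h2⟩ := Finset.mem_filter.1 ha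
      exact ⟨hY a h1, h2⟩)).trans ?_
    rw [hc]
    calc (2 * R + 1) ^ ((M - 2) * (e + 1)) ≤ (3 * R) ^ ((M - 2) * (e + 1)) :=
          Nat.pow_le_pow_left (by omega) _
      _ = 3 ^ ((M - 2) * (e + 1)) * R ^ ((M - 2) * (e + 1)) := mul_pow _ _ _
      _ ≤ _ := by
          refine Nat.mul_le_mul_left _ (Nat.pow_le_pow_right hR ?_)
          obtain ⟨m, rfl⟩ : ∃ m, M = m + 2 := ⟨M - 2, by omega⟩
          simp only [Nat.add_sub_cancel]
          nlinarith
  have hYj : ∀ j ∈ (Finset.univ : Finset ι), (Yj j).card ≤ C * R ^ (M * e) := by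
    intro j _
    obtain ⟨k, hk⟩ := hrow j
    have hjk : j ≠ k := by rintro rfl; exact hk (hd0 j)
    obtain ⟨ε, hε0, hεL⟩ := exists_reindex M hM hc j k hjk
    have hs2 : α j k * α j k = 1 := by
      rcases hvals j k with h | h | h
      · rw [h]; rfl
      · exact absurd h hk
      · rw [h]; rfl
    let β : Matrix (Fin M) (Fin M) ℤ := fun i i' => α j k * α (ε i) (ε i')
    have hrw : ∀ (a : ι → Fin (e + 1) → ℤ) i l, ∑ i', β i i' * a (ε i') l = α j k * ∑ i', α (ε i) i' * a i' l := by
      intro a i l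
      rw [Finset.mul_sum, ← Equiv.sum_comp ε]
      refine Finset.sum_congr rfl fun i' _ => ?_
      simp only [β]; ring
    have hinj : Function.Injective (fun (a : ι → Fin (e + 1) → ℤ) (i : Fin M) => a (ε i)) := by
      intro a a' h
      funext i
      have := congrFun h (ε.symm i)
      simpa using this
    rw [← Finset.card_image_of_injective _ hinj]
    refine hC β ?_ ?_ ?_ ?_ ?_ R hR _ ?_
    · intro i i'; simp only [β]; rw [hskew (ε i) (ε i')]; ring
    · intro i i'
      simp only [β]
      rcases hvals j k with h | h | h <;> rcases hvals (ε i) (ε i') with h' | h' | h' <;>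
        simp [h, h']
    · intro i
      obtain ⟨i', hi'⟩ := hrow (ε i)
      exact ⟨ε.symm i', by simp only [β, Equiv.apply_symm_apply]; exact mul_ne_zero hk hi'⟩
    · simp only [β, hε0, hεL]; exact hs2
    · rintro I ⟨i, hi⟩ ⟨i', hi'⟩
      obtain ⟨x, hx, y, hy, hxy⟩ := hirr (ε.symm ⁻¹' I) ⟨ε i, by simpa using hi⟩ ⟨ε i', by simpa using hi'⟩
      exact ⟨ε.symm x, hx, ε.symm y, hy, by
        simp only [β, Equiv.apply_symm_apply]; exact mul_ne_zero hk hxy⟩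
    · intro b hb
      obtain ⟨a, ha, rfl⟩ := Finset.mem_image.1 hb
      obtain ⟨haY, hav⟩ := Finset.mem_filter.1 ha
      have hX := hY a haY
      refine ⟨⟨fun i l => hX.bd _ _, fun i => hX.ne _, fun i => ?_⟩, ?_⟩
      · simp only [hrw]
        have := hX.om (ε i)
        have h2 : ∀ l, a (ε i) l * (α j k * ∑ i', α (ε i) i' * a i' l) =
          α j k * (a (ε i) l * ∑ i', α (ε i) i' * a i' l) := fun l => by ring
        simp only [h2, ← Finset.mul_sum, this, mul_zero]
      · intro h
        apply hav
        funext l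
        have h1 := congrFun h l
        simp only [hrw, hε0] at h1
        rcases mul_eq_zero.1 h1 with h | h
        · exact absurd h hk
        · exact h
  refine (Finset.card_le_card hcov).trans ((Finset.card_union_le _ _).trans ?_)
  rw [add_mul]
  refine add_le_add hY0 ?_
  refine Finset.card_biUnion_le.trans ((Finset.sum_le_card_nsmul _ _ _ hYj).trans ?_)
  rw [Finset.card_univ, hc, smul_eq_mul, mul_assoc]

theorem InX_restrict {ι : Type} [Fintype ι] {d : ℕ} (α : Matrix ι ι ℤ) (R : ℕ) (P : ι → Prop)
    [DecidablePred P] (hP : ∀ i j, P i → ¬ P j → α i j = 0) (a : ι → Fin d → ℤ) (ha : InX α R a) :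
    InX (fun i j : {i // P i} => α i.1 j.1) R (fun i : {i // P i} => a i.1) := by
  refine ⟨fun j k => ha.bd _ _, fun j => ha.ne _, fun j => ?_⟩
  rw [← ha.om j.1]
  refine Finset.sum_congr rfl fun k _ => ?_
  congr 1
  rw [← Fintype.sum_subtype_add_sum_subtype P]
  rw [Finset.sum_eq_zero (s := (Finset.univ : Finset {i // ¬ P i})), add_zero]
  intro i _
  rw [hP j.1 i.1 j.2 i.2, zero_mul]

theorem gen_count (e N : ℕ) (he : 2 ≤ e) (hMC : MCall (e + 1) N) (M : ℕ) : M ≤ N →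
    ∃ C : ℕ, ∀ (ι : Type) [Fintype ι], Fintype.card ι = M → ∀ α : Matrix ι ι ℤ,
        (∀ i j, α j i = -α i j) →
        (∀ i j, α i j = -1 ∨ α i j = 0 ∨ α i j = 1) →
        (∀ i, ∃ j, α i j ≠ 0) →
        ∀ R : ℕ, 1 ≤ R → ∀ Y : Finset (ι → Fin (e + 1) → ℤ),
        (∀ a ∈ Y, InX α R a) → Y.card ≤ C * R ^ (M * e) := by
  classical
  induction M using Nat.strong_induction_on with
  | _ M ih =>
  intro hMN
  by_cases hM : 2 ≤ M
  swap
  · refine ⟨1, ?_⟩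
    intro ι _ hc α hskew hvals hrow R hR Y hY
    by_cases hM0 : M = 0
    · subst hM0
      have : IsEmpty ι := Fintype.card_eq_zero_iff.1 hc
      have := Finset.card_le_one_of_subsingleton Y
      simpa using this
    · have : Fintype.card ι = 1 := by omega
      have hs := Fintype.card_le_one_iff_subsingleton.1 this.le
      obtain ⟨i⟩ : Nonempty ι := Fintype.card_pos_iff.1 (by omega)
      obtain ⟨j, hj⟩ := hrow i
      have h1 := hskew i i
      rw [Subsingleton.elim j i] at hj
      omega
  obtain ⟨C1, hC1⟩ := irred_count M e N hM hMN he hMC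
  have ih' : ∀ m : ℕ, ∃ C : ℕ, m < M → ∀ (ι : Type) [Fintype ι], Fintype.card ι = m → ∀ α : Matrix ι ι ℤ,
        (∀ i j, α j i = -α i j) →
        (∀ i j, α i j = -1 ∨ α i j = 0 ∨ α i j = 1) →
        (∀ i, ∃ j, α i j ≠ 0) →
        ∀ R : ℕ, 1 ≤ R → ∀ Y : Finset (ι → Fin (e + 1) → ℤ),
        (∀ a ∈ Y, InX α R a) → Y.card ≤ C * R ^ (m * e) := by
    intro m
    by_cases hm : m < M
    · obtain ⟨C, hC⟩ := ih m hm (by omega)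
      exact ⟨C, fun _ => hC⟩
    · exact ⟨0, fun h => absurd h hm⟩
  choose c hc using ih'
  refine ⟨C1 + ∑ m ∈ Finset.range M, c m * c (M - m), ?_⟩
  intro ι _ hcard α hskew hvals hrow R hR Y hY
  by_cases hirr : ∀ I : Set ι, I.Nonempty → Iᶜ.Nonempty → ∃ i ∈ I, ∃ j ∈ Iᶜ, α i j ≠ 0
  · refine (hC1 ι hcard α hskew hvals hrow hirr R hR Y hY).trans ?_
    exact Nat.mul_le_mul_right _ (Nat.le_add_right _ _)
  push Not at hirr
  obtain ⟨I, ⟨i0, hi0⟩, ⟨j0, hj0⟩, hI⟩ := hirr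
  let P : ι → Prop := fun i => i ∈ I
  have hP : ∀ i j, P i → ¬ P j → α i j = 0 := fun i j hi hj => hI i hi j hj
  have hQ : ∀ i j, ¬ P i → ¬ ¬ P j → α i j = 0 := fun i j hi hj => by
    rw [hskew j i, hP j i (not_not.1 hj) hi, neg_zero]
  set m := Fintype.card {i // P i} with hm
  have hm2 : Fintype.card {i // ¬ P i} = M - m := by
    rw [Fintype.card_subtype_compl, hcard]
  have hm0 : 0 < m := Fintype.card_pos_iff.2 ⟨⟨i0, hi0⟩⟩
  have hm1 : 0 < Fintype.card {i // ¬ P i} := Fintype.card_pos_iff.2 ⟨⟨j0, hj0⟩⟩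
  rw [hm2] at hm1
  have b1 := hc m (by omega) {i // P i} rfl (fun i j => α i.1 j.1) (fun i j => hskew _ _)
    (fun i j => hvals _ _) (fun i => by
      obtain ⟨j, hj⟩ := hrow i.1
      by_cases h : P j
      · exact ⟨⟨j, h⟩, hj⟩
      · exact absurd (hP _ _ i.2 h) hj) R hR (Y.image fun a i => a i.1) (by
      intro b hb
      obtain ⟨a, ha, rfl⟩ := Finset.mem_image.1 hb
      exact InX_restrict α R P hP a (hY a ha))
  have b2 := hc (M - m) (by omega) {i // ¬ P i} hm2 (fun i j => α i.1 j.1) (fun i j => hskew _ _)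
    (fun i j => hvals _ _) (fun i => by
      obtain ⟨j, hj⟩ := hrow i.1
      by_cases h : P j
      · exact absurd (hQ _ _ i.2 (not_not.2 h)) hj
      · exact ⟨⟨j, h⟩, hj⟩) R hR (Y.image fun a i => a i.1) (by
      intro b hb
      obtain ⟨a, ha, rfl⟩ := Finset.mem_image.1 hb
      exact InX_restrict α R (fun i => ¬ P i) hQ a (hY a ha))
  have b3 : Y.card ≤ ((Y.image fun a (i : {i // P i}) => a i.1) ×ˢ (Y.image fun a (i : {i // ¬ P i}) => a i.1)).card := by
    apply Finset.card_le_card_of_injOn (fun a => ((fun i => a i.1), (fun i => a i.1)))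
    · intro a ha
      exact Finset.mem_product.2 ⟨Finset.mem_image_of_mem _ ha, Finset.mem_image_of_mem _ ha⟩
    · intro a _ a' _ h
      simp only [Prod.mk.injEq] at h
      funext i
      by_cases hi : P i
      · exact congrFun h.1 ⟨i, hi⟩
      · exact congrFun h.2 ⟨i, hi⟩
  rw [Finset.card_product] at b3
  refine b3.trans ((Nat.mul_le_mul b1 b2).trans ?_)
  have e1 : M * e = m * e + (M - m) * e := by rw [← add_mul]; congr 1; omega
  rw [e1, pow_add]
  have e2 : c m * c (M - m) ≤ ∑ m ∈ Finset.range M, c m * c (M - m) :=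
    Finset.single_le_sum (f := fun m => c m * c (M - m)) (fun _ _ => Nat.zero_le _) (Finset.mem_range.2 (by omega))
  calc _ = (c m * c (M - m)) * (R ^ (m * e) * R ^ ((M - m) * e)) := by ring
    _ ≤ _ := Nat.mul_le_mul_right _ (e2.trans (Nat.le_add_left _ _))

end PartC4

section PartD1

open MvPolynomial

theorem norm_le_sqrt_sum (N d : ℕ) (z : Fin N → Fin d → ℝ) :
    ‖z‖ ≤ Real.sqrt (∑ j : Fin N, ∑ k : Fin d, (z j k) ^ 2) := by
  rw [pi_norm_le_iff_of_nonneg (Real.sqrt_nonneg _)]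
  intro j
  rw [pi_norm_le_iff_of_nonneg (Real.sqrt_nonneg _)]
  intro k
  rw [Real.norm_eq_abs]
  apply Real.abs_le_sqrt
  calc z j k ^ 2 ≤ ∑ k, z j k ^ 2 :=
        Finset.single_le_sum (f := fun k => z j k ^ 2) (fun _ _ => sq_nonneg _) (Finset.mem_univ k)
    _ ≤ _ := Finset.single_le_sum (f := fun j => ∑ k, z j k ^ 2)
        (fun _ _ => Finset.sum_nonneg fun _ _ => sq_nonneg _) (Finset.mem_univ j)

theorem exponent_bound (e N : ℕ) (hN : 3 ≤ N) :
    N * e + 2 ≤ N / 2 * N2 (e + 1) + (N - 2) * (e + 1 - 1) + 1 := by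
  have h1 : 2 * e + 2 ≤ N2 (e + 1) := by unfold N2; omega
  have h2 : N2 (e + 1) ≤ N / 2 * N2 (e + 1) := Nat.le_mul_of_pos_left _ (by omega)
  have h3 : N * e = (N - 2) * e + 2 * e := by rw [← add_mul]; congr 1; omega
  simp only [Nat.add_sub_cancel]
  omega

theorem final_sum (e N K : ℕ) (hN : 3 ≤ N) (hK : N * e + 2 ≤ K) (C0 : ℕ) (α : Matrix (Fin N) (Fin N) ℤ)
    (hC0 : ∀ R : ℕ, 1 ≤ R → ∀ Y : Finset (Fin N → Fin (e + 1) → ℤ),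
        (∀ a ∈ Y, InX α R a) → Y.card ≤ C0 * R ^ (N * e))
    (Φ : (Fin N → Fin (e + 1) → ℝ) → ℝ) (B : ℝ)
    (hΦ : ∀ z : Fin N → Fin (e + 1) → ℝ,
          |Φ z| * (max 1 (Real.sqrt (∑ j : Fin N, ∑ k : Fin (e + 1), (z j k) ^ 2))) ^ K ≤ B)
    (L : ℝ) (hL : 2 ≤ L) :
    |S_LN N (e + 1) α L Φ| ≤ (C0 * 2 ^ K * ∑' t : ℕ, 1 / (t : ℝ) ^ 2) * B := by
  classical
  have hL0 : 0 < L := by linarith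
  have hB : 0 ≤ B := le_trans (by positivity) (hΦ 0)
  set Z := ∑' t : ℕ, 1 / (t : ℝ) ^ 2 with hZ
  have hsum : Summable fun t : ℕ => 1 / (t : ℝ) ^ 2 := Real.summable_one_div_nat_pow.2 (by norm_num)
  unfold S_LN
  set S : Set (Fin N → Fin (e + 1) → ℤ) := {a : Fin N → Fin (e + 1) → ℤ |
          (∀ j : Fin N,
            ∑ k : Fin (e + 1), ((a j k : ℝ) / L) * ∑ i : Fin N, (α j i : ℝ) * ((a i k : ℝ) / L)
              = 0) ∧
          ∀ j : Fin N, ∃ k : Fin (e + 1), a j k ≠ 0} with hS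
  set f : (Fin N → Fin (e + 1) → ℤ) → ℝ :=
    S.indicator (fun a => Φ fun j k => (a j k : ℝ) / L) with hf
  let t : (Fin N → Fin (e + 1) → ℤ) → ℕ := fun a => ⌈‖fun j k => (a j k : ℝ) / L‖⌉₊
  have hbd : ∀ a j k, |(a j k : ℝ)| ≤ t a * L := by
    intro a j k
    have h1 : ‖(a j k : ℝ) / L‖ ≤ ‖fun j k => (a j k : ℝ) / L‖ :=
      (norm_le_pi_norm (fun k => (a j k : ℝ) / L) k).trans
        (norm_le_pi_norm (fun j k => (a j k : ℝ) / L) j)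
    have h2 := h1.trans (Nat.le_ceil _)
    rw [Real.norm_eq_abs, abs_div, abs_of_pos hL0, div_le_iff₀ hL0] at h2
    exact h2
  have hpos : ∀ a ∈ S, 1 ≤ t a := by
    intro a ha
    obtain ⟨k, hk⟩ := ha.2 ⟨0, by omega⟩
    by_contra h
    have h0 : t a = 0 := by omega
    have := hbd a ⟨0, by omega⟩ k
    rw [h0] at this
    simp at this
    exact hk this
  have hfa : ∀ a ∈ S, |f a| ≤ B * 2 ^ K / (t a : ℝ) ^ K := by
    intro a ha
    have ht := hpos a ha
    have ht0 : (0 : ℝ) < t a := by exact_mod_cast ht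
    rw [hf, Set.indicator_of_mem ha, le_div_iff₀ (by positivity)]
    have h1 := hΦ (fun j k => (a j k : ℝ) / L)
    have h2 := norm_le_sqrt_sum N (e + 1) (fun j k => (a j k : ℝ) / L)
    set W := max 1 (Real.sqrt (∑ j : Fin N, ∑ k : Fin (e + 1), ((a j k : ℝ) / L) ^ 2)) with hW
    have h3 : (t a : ℝ) ≤ 2 * W := by
      have h4 : (t a : ℝ) < ‖fun j k => (a j k : ℝ) / L‖ + 1 := Nat.ceil_lt_add_one (norm_nonneg _)
      have h5 : (1 : ℝ) ≤ W := le_max_left _ _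
      have h6 := h2.trans (le_max_right 1 _)
      linarith
    calc |Φ fun j k => (a j k : ℝ) / L| * (t a : ℝ) ^ K
        ≤ |Φ fun j k => (a j k : ℝ) / L| * (2 * W) ^ K := by gcongr
      _ = (|Φ fun j k => (a j k : ℝ) / L| * W ^ K) * 2 ^ K := by rw [mul_pow]; ring
      _ ≤ B * 2 ^ K := by gcongr
  have hcount : ∀ (s : Finset (Fin N → Fin (e + 1) → ℤ)) (T : ℕ), 1 ≤ T →
      (((s.filter fun a => a ∈ S).filter fun a => t a = T).card : ℝ) ≤ C0 * ((T : ℝ) * L) ^ (N * e) := by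
    intro s T hT
    have hT1 : (1 : ℝ) ≤ T := by exact_mod_cast hT
    have hR1 : 1 ≤ ⌊(T : ℝ) * L⌋₊ := by
      rw [Nat.one_le_floor_iff]; nlinarith
    have h1 := hC0 ⌊(T : ℝ) * L⌋₊ hR1 ((s.filter fun a => a ∈ S).filter fun a => t a = T) (by
      intro a ha
      simp only [Finset.mem_filter] at ha
      obtain ⟨⟨-, haS⟩, hat⟩ := ha
      refine ⟨fun j k => ?_, fun j h => ?_, fun j => ?_⟩
      · have h2 := hbd a j k
        rw [hat] at h2
        have h3 : (a j k).natAbs ≤ ⌊(T : ℝ) * L⌋₊ := by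
          apply Nat.le_floor
          rw [Nat.cast_natAbs]
          push_cast
          exact h2
        rw [Int.abs_eq_natAbs]
        exact_mod_cast h3
      · obtain ⟨k, hk⟩ := haS.2 j
        exact hk (by rw [h]; rfl)
      · have h2 := haS.1 j
        have h3 : ∑ k : Fin (e + 1), (a j k : ℝ) * ∑ i : Fin N, (α j i : ℝ) * (a i k : ℝ) =
            L ^ 2 * ∑ k : Fin (e + 1), ((a j k : ℝ) / L) * ∑ i : Fin N, (α j i : ℝ) * ((a i k : ℝ) / L) := by
          simp only [Finset.mul_sum]
          refine Finset.sum_congr rfl fun k _ => Finset.sum_congr rfl fun i _ => ?_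
          field_simp
        rw [h2, mul_zero] at h3
        exact_mod_cast h3)
    calc (((s.filter fun a => a ∈ S).filter fun a => t a = T).card : ℝ)
        ≤ ((C0 * ⌊(T : ℝ) * L⌋₊ ^ (N * e) : ℕ) : ℝ) := by exact_mod_cast h1
      _ = C0 * (⌊(T : ℝ) * L⌋₊ : ℝ) ^ (N * e) := by push_cast; rfl
      _ ≤ _ := by
        gcongr
        exact Nat.floor_le (by positivity)
  have hfin : ∀ s : Finset (Fin N → Fin (e + 1) → ℤ),
      ∑ a ∈ s, |f a| ≤ C0 * 2 ^ K * B * L ^ (N * e) * Z := by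
    intro s
    have h1 : ∑ a ∈ s, |f a| = ∑ a ∈ s.filter (fun a => a ∈ S), |f a| := by
      rw [Finset.sum_filter]
      refine Finset.sum_congr rfl fun a _ => ?_
      split_ifs with h
      · rfl
      · rw [hf, Set.indicator_of_notMem h, abs_zero]
    rw [h1, ← Finset.sum_fiberwise_of_maps_to (g := t) (t := (s.filter fun a => a ∈ S).image t)
      (fun a ha => Finset.mem_image_of_mem _ ha)]
    have h2 : ∀ T ∈ (s.filter fun a => a ∈ S).image t,
        ∑ a ∈ (s.filter fun a => a ∈ S).filter (fun a => t a = T), |f a| ≤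
          C0 * 2 ^ K * B * L ^ (N * e) * (1 / (T : ℝ) ^ 2) := by
      intro T hT
      obtain ⟨a0, ha0, hT0⟩ := Finset.mem_image.1 hT
      have hT1 : 1 ≤ T := hT0 ▸ hpos a0 (Finset.mem_filter.1 ha0).2
      have hT1' : (1 : ℝ) ≤ T := by exact_mod_cast hT1
      have hT0 : (0 : ℝ) < T := by linarith
      have h3 : ∀ a ∈ (s.filter fun a => a ∈ S).filter (fun a => t a = T), |f a| ≤ B * 2 ^ K / (T : ℝ) ^ K := by
        intro a ha
        simp only [Finset.mem_filter] at ha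
        have := hfa a ha.1.2
        rwa [ha.2] at this
      refine (Finset.sum_le_card_nsmul _ _ _ h3).trans ?_
      rw [nsmul_eq_mul]
      refine (mul_le_mul_of_nonneg_right (hcount s T hT1) (by positivity)).trans ?_
      have h4 : (T : ℝ) ^ (N * e) / (T : ℝ) ^ K ≤ 1 / (T : ℝ) ^ 2 := by
        rw [div_le_div_iff₀ (by positivity) (by positivity), one_mul, ← pow_add]
        exact pow_le_pow_right₀ hT1' hK
      calc C0 * ((T : ℝ) * L) ^ (N * e) * (B * 2 ^ K / (T : ℝ) ^ K)
          = C0 * 2 ^ K * B * L ^ (N * e) * ((T : ℝ) ^ (N * e) / (T : ℝ) ^ K) := by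
            rw [mul_pow]; ring
        _ ≤ _ := by gcongr
    refine (Finset.sum_le_sum h2).trans ?_
    rw [← Finset.mul_sum]
    gcongr
    exact hsum.sum_le_tsum _ (fun _ _ => by positivity)
  have habs : Summable fun a => |f a| := summable_of_sum_le (fun _ => abs_nonneg _) hfin
  have htot : |∑' a, f a| ≤ C0 * 2 ^ K * B * L ^ (N * e) * Z := by
    have h1 : ‖∑' a, f a‖ ≤ ∑' a, ‖f a‖ := norm_tsum_le_tsum_norm habs
    exact h1.trans (habs.tsum_le_of_sum_le hfin)
  rw [abs_mul, abs_of_pos (zpow_pos hL0 _)]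
  have hexp : L ^ ((N : ℤ) * (1 - ((e + 1 : ℕ) : ℤ))) * L ^ (N * e) = 1 := by
    rw [← zpow_natCast L (N * e), ← zpow_add₀ hL0.ne']
    have : (N : ℤ) * (1 - ((e + 1 : ℕ) : ℤ)) + ((N * e : ℕ) : ℤ) = 0 := by push_cast; ring
    rw [this, zpow_zero]
  calc L ^ ((N : ℤ) * (1 - ((e + 1 : ℕ) : ℤ))) * |∑' a, f a|
      ≤ L ^ ((N : ℤ) * (1 - ((e + 1 : ℕ) : ℤ))) * (C0 * 2 ^ K * B * L ^ (N * e) * Z) :=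
        mul_le_mul_of_nonneg_left htot (zpow_pos hL0 _).le
    _ = (L ^ ((N : ℤ) * (1 - ((e + 1 : ℕ) : ℤ))) * L ^ (N * e)) * ((C0 * 2 ^ K * Z) * B) := by ring
    _ = _ := by rw [hexp, one_mul]

theorem stmt_aux (d N : ℕ) (hd : 3 ≤ d) (hN : 3 ≤ N) (hMC : MCall d N) :
    ∃ C : ℝ, ∀ α : Matrix (Fin N) (Fin N) ℤ,
      (∀ i j, α j i = -α i j) →
      (∀ i j, α i j = -1 ∨ α i j = 0 ∨ α i j = 1) →
      (∀ i, ∃ j, α i j ≠ 0) →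
      ∀ Φ : (Fin N → Fin d → ℝ) → ℝ, ∀ B : ℝ,
        (∀ z : Fin N → Fin d → ℝ,
          |Φ z| * (max 1 (Real.sqrt (∑ j : Fin N, ∑ k : Fin d, (z j k) ^ 2)))
              ^ (N / 2 * N2 d + (N - 2) * (d - 1) + 1) ≤ B) →
        ∀ L : ℝ, 2 ≤ L → |S_LN N d α L Φ| ≤ C * B := by
  obtain ⟨e, rfl⟩ : ∃ e, d = e + 1 := ⟨d - 1, by omega⟩
  obtain ⟨C0, hC0⟩ := gen_count e N (by omega) hMC N le_rfl
  exact ⟨_, fun α h1 h2 h3 Φ B hΦ L hL => final_sum e N _ hN (exponent_bound e N hN) C0 α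
    (hC0 (Fin N) (Fintype.card_fin N) α h1 h2 h3) Φ B hΦ L hL⟩

end PartD1

/-- assuming the Main Conjecture over every `F̄_p` for every irreducible
skew-symmetric `{-1,0,1}`-matrix of size at most `N`, there is a constant `C_{d,N}`
(depending only on `d` and `N`) such that `|S_{L,N}(Φ)| ≤ C_{d,N} ‖Φ‖_{0,N̄}` for
`N̄ = ⌊N/2⌋N₂(d) + (N-2)(d-1) + 1`. -/
theorem stmt9 (d N : ℕ) (hd : 3 ≤ d) (hN : 3 ≤ N)
    (hMC : ∀ (p : ℕ) [Fact p.Prime], ∀ (M : ℕ) (_h2 : 2 ≤ M) (_hMN : M ≤ N)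
        (β : Matrix (Fin M) (Fin M) ℤ),
        (∀ i j, β j i = -β i j) →
        (∀ i j, β i j = -1 ∨ β i j = 0 ∨ β i j = 1) →
        (∀ i, ∃ j, β i j ≠ 0) →
        β ⟨0, by omega⟩ ⟨M - 1, by omega⟩ = 1 →
        MatIrreducible β →
        MainConj M d (AlgebraicClosure (ZMod p)) β) :
    ∃ C : ℝ, ∀ α : Matrix (Fin N) (Fin N) ℤ,
      (∀ i j, α j i = -α i j) →
      (∀ i j, α i j = -1 ∨ α i j = 0 ∨ α i j = 1) →
      (∀ i, ∃ j, α i j ≠ 0) →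
      ∀ Φ : (Fin N → Fin d → ℝ) → ℝ, ∀ B : ℝ,
        (∀ z : Fin N → Fin d → ℝ,
          |Φ z| * (max 1 (Real.sqrt (∑ j : Fin N, ∑ k : Fin d, (z j k) ^ 2)))
              ^ (N / 2 * N2 d + (N - 2) * (d - 1) + 1) ≤ B) →
        ∀ L : ℝ, 2 ≤ L → |S_LN N d α L Φ| ≤ C * B := by
  exact stmt_aux d N hd hN hMC
end

section
/- Let N ≥ 3 and d ≥ 2, let the skew-symmetric matrix α (entries in {−1,0,1} ⊂ ℚ, no zero row, α_{1N} = 1) be irreducible, and assume that for every prime p the Main Conjecture holds for α over the algebraic closure of F_p. Then there is a constant C(N,d) such that for every L ≥ 1, every R > 0 with RL ≥ 1, and every (z₁, v) ∈ (Q₁ ∩ ℤ_L^{2d}) ∩ A₂ (real points with coordinates in ℤ_L), the number of points of Q(z₁,v) ∩ ℤ_L^{(N−2)d} lying in the open cube B_R^{(N−2)d} = {|z|_∞ < R} ⊂ ℝ^{(N−2)d} is at most C(N,d) (RL)^{(N−2)(d−1)}. -/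
open MvPolynomial



set_option linter.unusedSectionVars false

section partA
variable {K : Type*} [Field K] [IsAlgClosed K] {σ : Type*} [Fintype σ]

lemma aux_translate (a : σ → K) :
    ∃ e : MvPolynomial σ K ≃ₐ[K] MvPolynomial σ K, ∀ i, e (X i) = X i + C (a i) := by
  refine ⟨AlgEquiv.ofAlgHom (aeval fun i => X i + C (a i)) (aeval fun i => X i - C (a i))
    ?_ ?_, ?_⟩
  · ext i : 1; simp [← algebraMap_eq]
  · ext i : 1; simp [← algebraMap_eq]
  · intro i; simp

lemma aux_height_point (x y : σ → K) :
    (vanishingIdeal K {x} : Ideal (MvPolynomial σ K)).height =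
      (vanishingIdeal K {y} : Ideal (MvPolynomial σ K)).height := by
  obtain ⟨e, he⟩ := aux_translate (fun i => x i - y i)
  have h : (vanishingIdeal K {y} : Ideal (MvPolynomial σ K)).comap (e.toRingEquiv) =
      vanishingIdeal K {x} := by
    ext p
    have hc : (aeval y).comp e.toAlgHom = (aeval x : MvPolynomial σ K →ₐ[K] K) := by
      ext i; simp [he]
    have := DFunLike.congr_fun hc p
    simp only [Ideal.mem_comap, mem_vanishingIdeal_singleton_iff]
    rw [← this]; rfl
  rw [← h]
  exact RingEquiv.height_comap _ _

lemma aux_height_max (m : Ideal (MvPolynomial σ K)) (hm : m.IsMaximal) :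
    m.height = Fintype.card σ := by
  have hdim : ringKrullDim (MvPolynomial σ K) = Fintype.card σ := by
    rw [MvPolynomial.ringKrullDim_of_isNoetherianRing, ringKrullDim_eq_zero_of_field]
    simp
  have : FiniteRingKrullDim (MvPolynomial σ K) := by
    rw [finiteRingKrullDim_iff_ne_bot_and_top, hdim]
    exact ⟨by exact WithBot.coe_ne_bot, by
      intro h
      have : ((Fintype.card σ : ℕ∞) : WithBot ℕ∞) = ((⊤ : ℕ∞) : WithBot ℕ∞) := h
      exact ENat.natCast_ne_top _ (WithBot.coe_injective this)⟩
  obtain ⟨p, hp, hph⟩ := Ideal.exists_isMaximal_height (R := MvPolynomial σ K)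
  obtain ⟨x, rfl⟩ := isMaximal_iff_eq_vanishingIdeal_singleton.1 hm
  obtain ⟨y, rfl⟩ := isMaximal_iff_eq_vanishingIdeal_singleton.1 hp
  rw [aux_height_point x y]
  rw [hdim] at hph
  exact WithBot.coe_injective hph

lemma aux_dim_ge (s : Finset (MvPolynomial σ K)) (Q : Ideal (MvPolynomial σ K))
    (hQ : Q ∈ (Ideal.span (s : Set (MvPolynomial σ K))).minimalPrimes) :
    ((Fintype.card σ : ℕ) : WithBot ℕ∞) ≤ ringKrullDim (MvPolynomial σ K ⧸ Q) + s.card := by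
  classical
  set I := Ideal.span (s : Set (MvPolynomial σ K)) with hI
  have hQp : Q.IsPrime := hQ.1.1
  have hfin := I.finite_minimalPrimes_of_isNoetherianRing
  -- an element in all other minimal primes but not in Q
  have hh : ¬ ((hfin.toFinset.erase Q).inf id ≤ Q) := by
    rw [hQp.inf_le']
    rintro ⟨P, hP, hPQ⟩
    simp only [Finset.mem_erase, Set.Finite.mem_toFinset] at hP
    exact hP.1 (le_antisymm hPQ (hQ.2 hP.2.1 hPQ))
  obtain ⟨h, hh1, hh2⟩ := SetLike.not_le_iff_exists.1 hh
  have hjac : h ∉ Q.jacobson := by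
    rw [← Ideal.radical_eq_jacobson, hQp.radical]; exact hh2
  rw [Ideal.jacobson, Ideal.mem_sInf] at hjac
  push Not at hjac
  obtain ⟨m, ⟨hQm, hm⟩, hhm⟩ := hjac
  have hsm : (s : Set (MvPolynomial σ K)) ⊆ m :=
    Ideal.span_le.1 ((hQ.1.2).trans hQm)
  have key : ∀ P : Ideal (MvPolynomial σ K), P.IsPrime → I ≤ P → P ≤ m → Q ≤ P := by
    intro P hP hIP hPm
    obtain ⟨P', hP', hP'P⟩ := Ideal.exists_minimalPrimes_le hIP
    by_cases hQP : P' = Q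
    · exact hQP ▸ hP'P
    · exfalso
      apply hhm
      have : (hfin.toFinset.erase Q).inf id ≤ P' :=
        Finset.inf_le (f := id) (by simp [hQP, hP'])
      exact hPm (hP'P (this hh1))
  have h1 := Ideal.height_le_height_add_encard_of_subset (s : Set (MvPolynomial σ K)) (p := m) hsm
  rw [aux_height_max m hm, Set.encard_coe_eq_coe_finsetCard] at h1
  have hIm : I ≤ m := Ideal.span_le.2 hsm
  have hm' : (m.map (Ideal.Quotient.mk I)).IsPrime :=
    Ideal.map_isPrime_of_surjective Ideal.Quotient.mk_surjective (by simpa using hIm)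
  have hcm : (m.map (Ideal.Quotient.mk I)).comap (Ideal.Quotient.mk I) = m := by
    rw [Ideal.comap_map_of_surjective _ Ideal.Quotient.mk_surjective]
    simpa [← RingHom.ker_eq_comap_bot] using hIm
  obtain ⟨l, hl1, hl2⟩ := Ideal.exists_ltSeries_length_eq_height (m.map (Ideal.Quotient.mk I))
  have h2 : ((m.map (Ideal.Quotient.mk I)).height : WithBot ℕ∞) ≤
      ringKrullDim (MvPolynomial σ K ⧸ Q) := by
    rw [ringKrullDim_quotient, ← hl2]
    let φ := PrimeSpectrum.comap (Ideal.Quotient.mk I)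
    have hφ : ∀ i, φ (l i) ∈ PrimeSpectrum.zeroLocus (Q : Set (MvPolynomial σ K)) := by
      intro i
      refine key _ (φ (l i)).2 ?_ ?_
      · intro x hx
        change Ideal.Quotient.mk I x ∈ (l i).asIdeal
        rw [Ideal.Quotient.eq_zero_iff_mem.2 hx]; exact zero_mem _
      · have hle : (l i).asIdeal ≤ l.last.asIdeal := l.monotone (Fin.le_last i)
        rw [hl1] at hle
        calc _ ≤ _ := Ideal.comap_mono hle
          _ = m := hcm
    let l' : LTSeries (PrimeSpectrum.zeroLocus (Q : Set (MvPolynomial σ K))) :=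
      ⟨l.length, fun i => ⟨φ (l i), hφ i⟩, fun i => by
        have hlt : l i.castSucc < l i.succ := l.step i
        change (⟨φ (l i.castSucc), hφ _⟩ : PrimeSpectrum.zeroLocus (Q : Set (MvPolynomial σ K))) <
          ⟨φ (l i.succ), hφ _⟩
        refine lt_of_le_of_ne ?_ ?_
        · exact Ideal.comap_mono hlt.le
        · intro he
          have := Ideal.comap_injective_of_surjective _ (Ideal.Quotient.mk_surjective (I := I))
            (congrArg PrimeSpectrum.asIdeal (congrArg Subtype.val he))
          exact hlt.ne (PrimeSpectrum.ext this)⟩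
    exact Order.LTSeries.length_le_krullDim l'
  calc ((Fintype.card σ : ℕ) : WithBot ℕ∞) = (((Fintype.card σ : ℕ) : ℕ∞) : WithBot ℕ∞) := rfl
    _ ≤ (((m.map (Ideal.Quotient.mk I)).height + s.card : ℕ∞) : WithBot ℕ∞) :=
      WithBot.coe_le_coe.2 h1
    _ = ((m.map (Ideal.Quotient.mk I)).height : WithBot ℕ∞) + s.card := rfl
    _ ≤ _ := by gcongr
end partA

section partB
variable {K : Type*} [Field K] {σ : Type*} [Fintype σ]

/-- image of the polynomials of degree at most `t` in the quotient by `J` -/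
noncomputable def auxFil (J : Ideal (MvPolynomial σ K)) (t : ℕ) :
    Submodule K (MvPolynomial σ K ⧸ J) :=
  (restrictTotalDegree σ K t).map (Ideal.Quotient.mkₐ K J).toLinearMap

/-- affine Hilbert function -/
noncomputable def auxHF (J : Ideal (MvPolynomial σ K)) (t : ℕ) : ℕ :=
  Module.finrank K (auxFil J t)

lemma aux_rtd_le (t : ℕ) : restrictTotalDegree σ K t ≤ restrictDegree σ K t := by
  intro p hp
  rw [mem_restrictTotalDegree] at hp
  rw [mem_restrictDegree]
  intro s hs i
  exact (Finsupp.le_degree i s).trans ((le_totalDegree hs).trans hp)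

lemma aux_rd (t : ℕ) : Module.Finite K (restrictDegree σ K t) ∧
    Module.finrank K (restrictDegree σ K t) ≤ (t + 1) ^ Fintype.card σ := by
  classical
  let F : (σ → Fin (t + 1)) → MvPolynomial σ K :=
    fun f => monomial (Finsupp.equivFunOnFinite.symm fun i => (f i : ℕ)) 1
  have hle : restrictDegree σ K t ≤ Submodule.span K (Set.range F) := by
    intro p hp
    rw [mem_restrictDegree] at hp
    rw [p.as_sum]
    refine Submodule.sum_mem _ fun s hs => ?_
    have : monomial s (coeff s p) =
        coeff s p • F (fun i => ⟨s i, Nat.lt_succ_of_le (hp s hs i)⟩) := by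
      simp only [F, smul_monomial, smul_eq_mul, mul_one]
      rw [show (Finsupp.equivFunOnFinite.symm fun i => s i) = s by ext i; simp]
    rw [this]
    exact Submodule.smul_mem _ _ (Submodule.subset_span ⟨_, rfl⟩)
  have hf : Module.Finite K (Submodule.span K (Set.range F)) :=
    Module.Finite.span_of_finite K (Set.finite_range F)
  refine ⟨Submodule.finiteDimensional_of_le hle, (Submodule.finrank_mono hle).trans ?_⟩
  refine (finrank_range_le_card F).trans ?_
  simp

instance aux_fin1 (t : ℕ) : Module.Finite K (restrictTotalDegree σ K t) :=
  haveI := (aux_rd (K := K) (σ := σ) t).1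
  Submodule.finiteDimensional_of_le (aux_rtd_le t)

instance aux_fin2 (J : Ideal (MvPolynomial σ K)) (t : ℕ) : Module.Finite K (auxFil J t) := by
  unfold auxFil; infer_instance

lemma aux_HF_le (J : Ideal (MvPolynomial σ K)) (t : ℕ) :
    auxHF J t ≤ (t + 1) ^ Fintype.card σ := by
  have := (aux_rd (K := K) (σ := σ) t).1
  exact (Submodule.finrank_map_le _ _).trans
    ((Submodule.finrank_mono (aux_rtd_le t)).trans (aux_rd t).2)

lemma aux_HF_mono (J : Ideal (MvPolynomial σ K)) {t t' : ℕ} (h : t ≤ t') :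
    auxHF J t ≤ auxHF J t' := by
  apply Submodule.finrank_mono
  apply Submodule.map_mono
  intro p hp
  rw [mem_restrictTotalDegree] at hp ⊢
  exact hp.trans h

lemma aux_HF_step (J J' : Ideal (MvPolynomial σ K)) (hJ : J ≤ J') (g : MvPolynomial σ K)
    (hg : g ∈ J') (hdeg : g.totalDegree ≤ 2) (hreg : ∀ x, g * x ∈ J → x ∈ J) (t : ℕ) :
    auxHF J' (t + 2) + auxHF J t ≤ auxHF J (t + 2) := by
  let π : (MvPolynomial σ K ⧸ J) →ₗ[K] (MvPolynomial σ K ⧸ J') :=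
    (Ideal.Quotient.factorₐ K hJ).toLinearMap
  let ρ := π.domRestrict (auxFil J (t + 2))
  have hrk := LinearMap.finrank_range_add_finrank_ker ρ
  have hrange : LinearMap.range ρ = auxFil J' (t + 2) := by
    rw [LinearMap.range_domRestrict]
    unfold auxFil
    rw [← Submodule.map_comp]
    congr 1
  rw [hrange] at hrk
  let μ : (MvPolynomial σ K ⧸ J) →ₗ[K] (MvPolynomial σ K ⧸ J) :=
    LinearMap.mulLeft K (Ideal.Quotient.mk J g)
  have hμ : Function.Injective μ := by
    rw [injective_iff_map_eq_zero]
    intro a ha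
    obtain ⟨x, rfl⟩ := Ideal.Quotient.mk_surjective a
    have : Ideal.Quotient.mk J (g * x) = 0 := by simpa [μ] using ha
    exact Ideal.Quotient.eq_zero_iff_mem.2 (hreg x (Ideal.Quotient.eq_zero_iff_mem.1 this))
  have hker : auxHF J t ≤ Module.finrank K (LinearMap.ker ρ) := by
    have h1 : auxHF J t = Module.finrank K ((auxFil J t).map μ) :=
      (LinearEquiv.finrank_eq (Submodule.equivMapOfInjective μ hμ _))
    rw [h1, ← Submodule.finrank_map_subtype_eq (auxFil J (t+2)) (LinearMap.ker ρ)]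
    apply Submodule.finrank_mono
    rintro _ ⟨_, ⟨x, hx, rfl⟩, rfl⟩
    have hmem : μ ((Ideal.Quotient.mkₐ K J).toLinearMap x) ∈ auxFil J (t + 2) := by
      refine ⟨g * x, ?_, ?_⟩
      · rw [SetLike.mem_coe, mem_restrictTotalDegree] at hx ⊢
        exact (totalDegree_mul _ _).trans (by omega)
      · simp [μ]
    refine ⟨⟨_, hmem⟩, ?_, rfl⟩
    change π (μ ((Ideal.Quotient.mkₐ K J).toLinearMap x)) = 0
    have : π (μ ((Ideal.Quotient.mkₐ K J).toLinearMap x)) = Ideal.Quotient.mk J' (g * x) := by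
      simp [π, μ]
    rw [this]
    exact Ideal.Quotient.eq_zero_iff_mem.2 (Ideal.mul_mem_right _ _ hg)
  change auxHF J' (t + 2) + _ = auxHF J (t+2) at hrk
  omega

lemma aux_HF_step2 (J J' : Ideal (MvPolynomial σ K)) 
    (h : ∀ t, auxHF J' (t + 2) + auxHF J t ≤ auxHF J (t + 2)) (t : ℕ) :
    auxHF J' t * t ≤ auxHF J (3 * t) := by
  have : ∀ k, auxHF J' t * k ≤ auxHF J (t + 2 * k) := by
    intro k
    induction k with
    | zero => simp
    | succ k ih =>
      have h1 := h (t + 2 * k)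
      have h2 := aux_HF_mono J' (show t ≤ t + 2 * k + 2 by omega)
      rw [mul_add, mul_one, show t + 2 * (k + 1) = t + 2 * k + 2 by ring]
      omega
  have := this t
  rwa [show t + 2 * t = 3 * t by ring] at this

lemma aux_points (J : Ideal (MvPolynomial σ K)) (S : Finset K) (W : Finset (σ → K))
    (hWS : ∀ w ∈ W, ∀ i, w i ∈ S) (hWJ : ∀ w ∈ W, ∀ p ∈ J, eval w p = 0) :
    W.card ≤ auxHF J (Fintype.card σ * S.card) := by
  classical
  let P : (σ → K) → MvPolynomial σ K := fun w => ∏ i, ∏ s ∈ S.erase (w i), (X i - C s)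
  have hdeg : ∀ w, P w ∈ restrictTotalDegree σ K (Fintype.card σ * S.card) := by
    intro w
    rw [mem_restrictTotalDegree]
    refine (totalDegree_finsetProd _ _).trans ?_
    calc _ ≤ ∑ i : σ, S.card := Finset.sum_le_sum fun i _ => ?_
      _ = _ := by simp
    refine (totalDegree_finsetProd _ _).trans ?_
    calc _ ≤ ∑ s ∈ S.erase (w i), 1 := Finset.sum_le_sum fun s _ => by
            refine (totalDegree_sub_C_le _ _).trans (by simp)
      _ = (S.erase (w i)).card := by simp
      _ ≤ _ := Finset.card_le_card (Finset.erase_subset _ _)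
  have hself : ∀ w, eval w (P w) ≠ 0 := by
    intro w
    simp only [P, map_prod, map_sub, eval_X, eval_C, Finset.prod_ne_zero_iff]
    intro i _ s hs
    rw [sub_ne_zero]
    exact (Finset.ne_of_mem_erase hs).symm
  have hother : ∀ w, ∀ w' ∈ W, w' ≠ w → eval w' (P w) = 0 := by
    intro w w' hw' hne
    obtain ⟨i, hi⟩ := Function.ne_iff.1 hne
    simp only [P, map_prod, map_sub, eval_X, eval_C]
    refine Finset.prod_eq_zero (Finset.mem_univ i) ?_
    exact Finset.prod_eq_zero (i := w' i) (by simp [hi, hWS w' hw' i]) (sub_self _)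
  let F : W → auxFil J (Fintype.card σ * S.card) :=
    fun w => ⟨Ideal.Quotient.mkₐ K J (P w), ⟨P w, hdeg w, rfl⟩⟩
  have hli : LinearIndependent K F := by
    rw [Fintype.linearIndependent_iff]
    intro c hc w
    have h1 : ∑ w : W, c w • Ideal.Quotient.mkₐ K J (P w) = 0 := by
      have := congrArg Subtype.val hc
      simpa [F] using this
    have h2 : (∑ w : W, c w • P w) ∈ J := by
      rw [← Ideal.Quotient.eq_zero_iff_mem, ← h1, ← Ideal.Quotient.mkₐ_eq_mk K]
      simp only [map_sum, map_smul]
    have h3 := hWJ w w.2 _ h2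
    simp only [map_sum, smul_eval] at h3
    rw [Finset.sum_eq_single w] at h3
    · exact (mul_eq_zero.1 h3).resolve_right (hself _)
    · intro b _ hb
      rw [hother b w w.2 (fun h => hb (Subtype.ext h.symm)), mul_zero]
    · simp
  have := hli.fintype_card_le_finrank
  rw [Fintype.card_coe] at this
  exact this
end partB

section partC
variable {K : Type*} [Field K] [IsAlgClosed K] {σ : Type*} [Fintype σ]

lemma aux_avoid {c e : ℕ} (f : Fin c → MvPolynomial σ K)
    (hce : e + c = Fintype.card σ)
    (hdim : ringKrullDim (MvPolynomial σ K ⧸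
      vanishingIdeal K {w : σ → K | ∀ j, eval w (f j) = 0}) = ((e : ℕ) : WithBot ℕ∞))
    (s : Finset (MvPolynomial σ K)) (hs : s.card < c) :
    ∃ g ∈ Submodule.span K (Set.range f),
      ∀ Q ∈ (Ideal.span (s : Set (MvPolynomial σ K))).minimalPrimes, g ∉ Q := by
  classical
  set I := Ideal.span (s : Set (MvPolynomial σ K)) with hI
  set W := Submodule.span K (Set.range f) with hW
  have hfin := I.finite_minimalPrimes_of_isNoetherianRing
  have : Finite I.minimalPrimes := hfin
  let p : I.minimalPrimes → Subspace K W :=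
    fun Q => (Submodule.restrictScalars K (Q : Ideal (MvPolynomial σ K))).comap W.subtype
  by_contra hcon
  push Not at hcon
  have hcov : ⋃ Q, (p Q : Set W) = Set.univ := by
    rw [Set.eq_univ_iff_forall]
    intro g
    obtain ⟨Q, hQ, hgQ⟩ := hcon g g.2
    exact Set.mem_iUnion.2 ⟨⟨Q, hQ⟩, hgQ⟩
  obtain ⟨⟨Q, hQ⟩, hp⟩ := Subspace.exists_eq_top_of_iUnion_eq_univ hcov
  have hfQ : ∀ j, f j ∈ Q := by
    intro j
    have : (⟨f j, Submodule.subset_span ⟨j, rfl⟩⟩ : W) ∈ p ⟨Q, hQ⟩ := by rw [hp]; trivial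
    exact this
  have hQp : Q.IsPrime := hQ.1.1
  have hVQ : vanishingIdeal K {w : σ → K | ∀ j, eval w (f j) = 0} ≤ Q := by
    conv_rhs => rw [← MvPolynomial.IsPrime.vanishingIdeal_zeroLocus (K := K) Q]
    apply vanishingIdeal_anti_mono
    intro w hw j
    have := hw (f j) (hfQ j)
    simpa [aeval_eq_eval] using this
  have h1 : ringKrullDim (MvPolynomial σ K ⧸ Q) ≤ ((e : ℕ) : WithBot ℕ∞) := by
    rw [← hdim]
    exact ringKrullDim_le_of_surjective (Ideal.Quotient.factor hVQ)
      (Ideal.Quotient.factor_surjective hVQ)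
  have h2 := aux_dim_ge s Q hQ
  have h3 : ((Fintype.card σ : ℕ) : WithBot ℕ∞) ≤ ((e + s.card : ℕ) : WithBot ℕ∞) := by
    refine h2.trans ?_
    push_cast
    gcongr
  have h4 : Fintype.card σ ≤ e + s.card := by exact_mod_cast h3
  omega

lemma aux_chain {c e : ℕ} (f : Fin c → MvPolynomial σ K) (hf : ∀ j, (f j).totalDegree ≤ 2)
    (hce : e + c = Fintype.card σ)
    (hdim : ringKrullDim (MvPolynomial σ K ⧸
      vanishingIdeal K {w : σ → K | ∀ j, eval w (f j) = 0}) = ((e : ℕ) : WithBot ℕ∞))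
    (i : ℕ) (hi : i ≤ c) :
    ∃ s : Finset (MvPolynomial σ K), s.card ≤ i ∧
      (∀ g ∈ s, g ∈ Submodule.span K (Set.range f)) ∧
      ∀ t, auxHF (Ideal.span (s : Set (MvPolynomial σ K))).radical t * t ^ i ≤
        (3 ^ i * t + 1) ^ Fintype.card σ := by
  classical
  induction i with
  | zero =>
    refine ⟨∅, by simp, by simp, fun t => ?_⟩
    simpa using aux_HF_le _ t
  | succ i ih =>
    obtain ⟨s, hs1, hs2, hs3⟩ := ih (by omega)
    obtain ⟨g, hg, hgQ⟩ := aux_avoid f hce hdim s (by omega)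
    refine ⟨insert g s, (Finset.card_insert_le _ _).trans (by omega), ?_, fun t => ?_⟩
    · intro x hx
      rcases Finset.mem_insert.1 hx with rfl | hx
      · exact hg
      · exact hs2 x hx
    · have hdeg : g.totalDegree ≤ 2 := by
        have : Submodule.span K (Set.range f) ≤ restrictTotalDegree σ K 2 := by
          rw [Submodule.span_le]
          rintro _ ⟨j, rfl⟩
          exact (mem_restrictTotalDegree _ _ _).2 (hf j)
        exact (mem_restrictTotalDegree _ _ _).1 (this hg)
      have hstep := aux_HF_step2 _ _ (aux_HF_step
        (Ideal.span (s : Set (MvPolynomial σ K))).radical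
        (Ideal.span ((insert g s : Finset _) : Set (MvPolynomial σ K))).radical
        (Ideal.radical_mono (Ideal.span_mono (by simp)))
        g (Ideal.le_radical (Ideal.subset_span (by simp))) hdeg (by
          intro x hx
          rw [← Ideal.sInf_minimalPrimes, Ideal.mem_sInf] at hx ⊢
          intro Q hQ
          exact (hQ.1.1.mem_or_mem (hx hQ)).resolve_left (hgQ Q hQ))) t
      calc _ = auxHF (Ideal.span ((insert g s : Finset _) : Set (MvPolynomial σ K))).radical t
              * t * t ^ i := by ring
        _ ≤ auxHF (Ideal.span (s : Set (MvPolynomial σ K))).radical (3 * t) * (3 * t) ^ i := by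
            gcongr; omega
        _ ≤ _ := hs3 _
        _ = _ := by ring

lemma aux_count {c e : ℕ} (f : Fin c → MvPolynomial σ K) (hf : ∀ j, (f j).totalDegree ≤ 2)
    (hce : e + c = Fintype.card σ)
    (hdim : ringKrullDim (MvPolynomial σ K ⧸
      vanishingIdeal K {w : σ → K | ∀ j, eval w (f j) = 0}) = ((e : ℕ) : WithBot ℕ∞))
    (S : Finset K) (W : Finset (σ → K))
    (hWS : ∀ w ∈ W, ∀ i, w i ∈ S) (hWf : ∀ w ∈ W, ∀ j, eval w (f j) = 0)
    (T : ℕ) (hT : 0 < T) (hST : Fintype.card σ * S.card ≤ T) :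
    W.card ≤ (2 * 3 ^ c) ^ Fintype.card σ * T ^ e := by
  obtain ⟨s, -, hs2, hs3⟩ := aux_chain f hf hce hdim c le_rfl
  have h1 := aux_points (Ideal.span (s : Set (MvPolynomial σ K))).radical S W hWS (by
    intro w hw p hp
    have hle : (Ideal.span (s : Set (MvPolynomial σ K))) ≤ RingHom.ker (eval w) := by
      rw [Ideal.span_le]
      intro g hg
      have hsp : Submodule.span K (Set.range f) ≤
          LinearMap.ker (aeval w : MvPolynomial σ K →ₐ[K] K).toLinearMap := by
        rw [Submodule.span_le]
        rintro _ ⟨j, rfl⟩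
        simpa [aeval_eq_eval] using hWf w hw j
      have := hsp (hs2 g hg)
      simpa [aeval_eq_eval] using this
    have hpr : (RingHom.ker (eval w)).IsPrime := RingHom.ker_isPrime _
    exact (hpr.radical_le_iff.2 hle) hp)
  have h2 := h1.trans (aux_HF_mono _ hST)
  have h3 := hs3 T
  have h4 : W.card * T ^ c ≤ ((2 * 3 ^ c) ^ Fintype.card σ * T ^ e) * T ^ c := by
    calc W.card * T ^ c ≤ _ := Nat.mul_le_mul_right _ h2
      _ ≤ _ := h3
      _ ≤ (2 * 3 ^ c * T) ^ Fintype.card σ := by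
        gcongr
        have : 0 < 3 ^ c * T := by positivity
        nlinarith
      _ = _ := by rw [mul_pow, ← hce, pow_add T e c]; ring
  exact Nat.le_of_mul_le_mul_right h4 (by positivity)
end partC

section partD

lemma aux_qeval (N d : ℕ) {K : Type*} [CommRing K] (α : Matrix (Fin N) (Fin N) ℤ)
    (z1 v : Fin d → K) (j : Fin (N - 2)) (w : Fin (N - 2) × Fin d → K) :
    eval w (qPolyInt N d K α z1 v j) = ∑ k : Fin d, w (j, k) *
      (((α ⟨j.1 + 1, by have := j.2; omega⟩ ⟨0, by have := j.2; omega⟩ : ℤ) * z1 k +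
            (α ⟨j.1 + 1, by have := j.2; omega⟩ ⟨N - 1, by have := j.2; omega⟩ : ℤ) * v k) +
        ∑ i : Fin (N - 2),
          (((α ⟨j.1 + 1, by have := j.2; omega⟩ ⟨i.1 + 1, by have := i.2; omega⟩ -
                  α ⟨j.1 + 1, by have := j.2; omega⟩ ⟨N - 1, by have := j.2; omega⟩ *
                    α ⟨0, by have := j.2; omega⟩ ⟨i.1 + 1, by have := i.2; omega⟩ : ℤ) : K)) *
            w (i, k)) := by
  simp only [qPolyInt, map_sum, map_mul, map_add, eval_X, eval_C]

lemma aux_qcast (N d : ℕ) (K : Type*) [CommRing K] (α : Matrix (Fin N) (Fin N) ℤ)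
    (z1 v : Fin d → ℤ) (j : Fin (N - 2)) (w : Fin (N - 2) × Fin d → ℤ) :
    eval (fun c => (w c : K)) (qPolyInt N d K α (fun k => (z1 k : K)) (fun k => (v k : K)) j) =
      ((eval w (qPolyInt N d ℤ α z1 v j) : ℤ) : K) := by
  rw [aux_qeval, aux_qeval]
  push_cast
  rfl

lemma aux_qscale (N d : ℕ) {K : Type*} [CommRing K] (α : Matrix (Fin N) (Fin N) ℤ)
    (z1 v : Fin d → K) (j : Fin (N - 2)) (w : Fin (N - 2) × Fin d → K) (a : K) :
    eval (fun c => a * w c) (qPolyInt N d K α (fun k => a * z1 k) (fun k => a * v k) j) =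
      a ^ 2 * eval w (qPolyInt N d K α z1 v j) := by
  rw [aux_qeval, aux_qeval, Finset.mul_sum]
  refine Finset.sum_congr rfl fun k _ => ?_
  have hsum : ∀ b : Fin (N - 2) → K, ∑ i, b i * (a * w (i, k)) = a * ∑ i, b i * w (i, k) := by
    intro b
    rw [Finset.mul_sum]
    exact Finset.sum_congr rfl fun i _ => by ring
  rw [hsum]
  ring

lemma aux_qdeg (N d : ℕ) {K : Type*} [CommRing K] [Nontrivial K] (α : Matrix (Fin N) (Fin N) ℤ)
    (z1 v : Fin d → K) (j : Fin (N - 2)) :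
    (qPolyInt N d K α z1 v j).totalDegree ≤ 2 := by
  unfold qPolyInt
  refine totalDegree_finsetSum_le fun k _ => ?_
  refine (totalDegree_mul _ _).trans ?_
  rw [totalDegree_X]
  have : ∀ p : MvPolynomial (Fin (N - 2) × Fin d) K, p.totalDegree ≤ 1 →
      1 + p.totalDegree ≤ 2 := fun p hp => by omega
  apply this
  refine (totalDegree_add _ _).trans (max_le (by rw [totalDegree_C]; omega) ?_)
  refine totalDegree_finsetSum_le fun i _ => ?_
  refine (totalDegree_mul _ _).trans ?_
  rw [totalDegree_X, totalDegree_C]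

/-- The integral count. -/
lemma aux_int (N d : ℕ) (hN : 3 ≤ N) (hd : 2 ≤ d)
    (α : Matrix (Fin N) (Fin N) ℤ)
    (hMC : ∀ (p : ℕ) [Fact p.Prime], MainConj N d (AlgebraicClosure (ZMod p)) α)
    (B : ℕ) (z1 v : Fin d → ℤ) (hzv : ∑ k, z1 k * v k = 0) (hz : z1 ≠ 0) (hv : v ≠ 0)
    (W : Finset (Fin (N - 2) × Fin d → ℤ))
    (hWB : ∀ w ∈ W, ∀ c, -(B : ℤ) ≤ w c ∧ w c ≤ B)
    (hW : ∀ w ∈ W, ∀ j, eval w (qPolyInt N d ℤ α z1 v j) = 0) :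
    W.card ≤ (2 * 3 ^ (N - 2)) ^ ((N - 2) * d) *
      ((N - 2) * d * (2 * B + 1)) ^ ((N - 2) * (d - 1)) := by
  classical
  obtain ⟨k1, hk1⟩ := Function.ne_iff.1 hz
  obtain ⟨k2, hk2⟩ := Function.ne_iff.1 hv
  simp only [Pi.zero_apply] at hk1 hk2
  obtain ⟨p, hp, hpp⟩ := Nat.exists_infinite_primes
    (2 * B + 1 + (z1 k1).natAbs + (v k2).natAbs)
  have : Fact p.Prime := ⟨hpp⟩
  let K := AlgebraicClosure (ZMod p)
  have : CharP K p := charP_of_injective_algebraMap (algebraMap (ZMod p) K).injective p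
  have hcast : ∀ m : ℤ, (m : K) = 0 → m.natAbs < p → m = 0 := by
    intro m hm hlt
    rw [CharP.intCast_eq_zero_iff K p] at hm
    exact Int.eq_zero_of_abs_lt_dvd hm (by rw [Int.abs_eq_natAbs]; exact_mod_cast hlt)
  let r : (Fin (N - 2) × Fin d → ℤ) → (Fin (N - 2) × Fin d → K) := fun w c => (w c : K)
  have hr : Set.InjOn r W := by
    intro w hw w' hw' h
    funext c
    have h1 : ((w c - w' c : ℤ) : K) = 0 := by
      push_cast
      exact sub_eq_zero.2 (congrFun h c)
    have := hWB w hw c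
    have := hWB w' hw' c
    have := hcast _ h1 (by omega)
    omega
  have hdim := hMC p (fun k => (z1 k : K)) (fun k => (v k : K))
    (by exact_mod_cast congrArg (fun x : ℤ => (x : K)) hzv)
    (fun h => hk1 (hcast _ (congrFun h k1) (by omega)))
    (fun h => hk2 (hcast _ (congrFun h k2) (by omega)))
  have hcard : Fintype.card (Fin (N - 2) × Fin d) = (N - 2) * d := by simp
  have hce : (N - 2) * (d - 1) + (N - 2) = Fintype.card (Fin (N - 2) × Fin d) := by
    rw [hcard]
    obtain ⟨d', rfl⟩ : ∃ d', d = d' + 1 := ⟨d - 1, by omega⟩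
    simp [mul_add]
  let S : Finset K := (Finset.Icc (-(B : ℤ)) B).image (fun m : ℤ => (m : K))
  have hS : S.card ≤ 2 * B + 1 := by
    refine Finset.card_image_le.trans ?_
    rw [Int.card_Icc]; omega
  have := aux_count (c := N - 2) (e := (N - 2) * (d - 1))
    (fun j => qPolyInt N d K α (fun k => (z1 k : K)) (fun k => (v k : K)) j)
    (fun j => aux_qdeg N d α _ _ j) hce hdim S (W.image r)
    (by
      intro w hw c
      obtain ⟨w, hw', rfl⟩ := Finset.mem_image.1 hw
      exact Finset.mem_image.2 ⟨w c, Finset.mem_Icc.2 (hWB w hw' c), rfl⟩)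
    (by
      intro w hw j
      obtain ⟨w, hw', rfl⟩ := Finset.mem_image.1 hw
      have := aux_qcast N d K α z1 v j w
      rw [hW w hw' j, Int.cast_zero] at this
      exact this)
    ((N - 2) * d * (2 * B + 1))
    (Nat.mul_pos (Nat.mul_pos (by omega) (by omega)) (by omega))
    (by rw [hcard]; exact Nat.mul_le_mul_left _ hS)
  rw [Finset.card_image_of_injOn hr, hcard] at this
  exact this
end partD

/-- assuming the Main Conjecture for `α` over every `F̄_p`, there is a constant
`C(N,d)` such that for every `L ≥ 1`, every `R > 0` with `RL ≥ 1` and every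
`(z₁,v) ∈ (Q₁ ∩ ℤ_L^{2d}) ∩ A₂`, the number of points of `Q(z₁,v) ∩ ℤ_L^{(N-2)d}` in the
open cube `{|z|_∞ < R}` is at most `C(N,d)(RL)^{(N-2)(d-1)}`. -/
theorem stmt10 (N d : ℕ) (hN : 3 ≤ N) (hd : 2 ≤ d)
    (α : Matrix (Fin N) (Fin N) ℤ)
    (hskew : ∀ i j, α j i = -α i j)
    (hent : ∀ i j, α i j = -1 ∨ α i j = 0 ∨ α i j = 1)
    (hrow : ∀ i, ∃ j, α i j ≠ 0)
    (h1N : α ⟨0, by omega⟩ ⟨N - 1, by omega⟩ = 1)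
    (hirr : MatIrreducible α)
    (hMC : ∀ (p : ℕ) [Fact p.Prime], MainConj N d (AlgebraicClosure (ZMod p)) α) :
    ∃ C : ℝ, ∀ L R : ℝ, 1 ≤ L → 0 < R → 1 ≤ R * L →
      ∀ z1 v : Fin d → ℝ,
        (∀ k, ∃ m : ℤ, z1 k = (m : ℝ) / L) → (∀ k, ∃ m : ℤ, v k = (m : ℝ) / L) →
        (∑ k : Fin d, z1 k * v k) = 0 → z1 ≠ 0 → v ≠ 0 →
        ({w : Fin (N - 2) × Fin d → ℝ |
            (∀ c, ∃ m : ℤ, w c = (m : ℝ) / L) ∧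
            (∀ j, MvPolynomial.eval w (qPolyInt N d ℝ α z1 v j) = 0) ∧
            ∀ c, |w c| < R}).Finite ∧
        ((({w : Fin (N - 2) × Fin d → ℝ |
            (∀ c, ∃ m : ℤ, w c = (m : ℝ) / L) ∧
            (∀ j, MvPolynomial.eval w (qPolyInt N d ℝ α z1 v j) = 0) ∧
            ∀ c, |w c| < R}).ncard : ℝ)
          ≤ C * (R * L) ^ ((N - 2) * (d - 1))) := by
  refine ⟨(2 * 3 ^ (N - 2)) ^ ((N - 2) * d) *
      (((N - 2 : ℕ) * d : ℝ) * 5) ^ ((N - 2) * (d - 1)), ?_⟩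
  intro L R hL hR hRL z1 v hz1 hv hzv hz10 hv0
  classical
  have hL0 : (0 : ℝ) < L := by linarith
  choose Z1 hZ1 using hz1
  choose V hV using hv
  set E := {w : Fin (N - 2) × Fin d → ℝ |
            (∀ c, ∃ m : ℤ, w c = (m : ℝ) / L) ∧
            (∀ j, MvPolynomial.eval w (qPolyInt N d ℝ α z1 v j) = 0) ∧
            ∀ c, |w c| < R} with hE
  set B : ℕ := ⌈R * L⌉₊ with hB
  have hBge : R * L ≤ B := Nat.le_ceil _
  have hBle : (B : ℝ) ≤ R * L + 1 := (Nat.ceil_lt_add_one (by linarith)).le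
  let ψ : (Fin (N - 2) × Fin d → ℤ) → (Fin (N - 2) × Fin d → ℝ) := fun m c => (m c : ℝ) / L
  let W : Finset (Fin (N - 2) × Fin d → ℤ) :=
    (Fintype.piFinset fun _ => Finset.Icc (-(B : ℤ)) B).filter
      fun m => ∀ j, eval m (qPolyInt N d ℤ α Z1 V j) = 0
  have hz1' : z1 = fun k => L⁻¹ * (Z1 k : ℝ) := by
    funext k; rw [hZ1, div_eq_inv_mul]
  have hv' : v = fun k => L⁻¹ * (V k : ℝ) := by
    funext k; rw [hV, div_eq_inv_mul]
  have hsub : E ⊆ ((W.image ψ : Finset _) : Set (Fin (N - 2) × Fin d → ℝ)) := by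
    rintro w ⟨hw1, hw2, hw3⟩
    choose m hm using hw1
    have hwm : w = fun c => L⁻¹ * (m c : ℝ) := by
      funext c; rw [hm, div_eq_inv_mul]
    rw [Finset.mem_coe, Finset.mem_image]
    refine ⟨m, ?_, (funext hm).symm⟩
    rw [Finset.mem_filter, Fintype.mem_piFinset]
    constructor
    · intro c
      have h1 := hw3 c
      rw [hm, abs_div, abs_of_pos hL0, div_lt_iff₀ hL0] at h1
      have h2 : |(m c : ℝ)| ≤ B := h1.le.trans hBge
      rw [abs_le] at h2
      rw [Finset.mem_Icc]
      exact ⟨by exact_mod_cast h2.1, by exact_mod_cast h2.2⟩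
    · intro j
      have h1 := hw2 j
      rw [hwm, hz1', hv', aux_qscale, aux_qcast] at h1
      have h2 : (L⁻¹) ^ 2 ≠ 0 := by positivity
      exact_mod_cast (mul_eq_zero.1 h1).resolve_left h2
  refine ⟨(Finset.finite_toSet _).subset hsub, ?_⟩
  have hWc := aux_int N d hN hd α hMC B Z1 V
    (by
      have : (∑ k, (Z1 k : ℝ) * V k) = 0 := by
        have h2 : L⁻¹ ^ 2 * (∑ k, (Z1 k : ℝ) * V k) = 0 := by
          rw [Finset.mul_sum, ← hzv]
          refine Finset.sum_congr rfl fun k _ => ?_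
          rw [hz1', hv']; ring
        exact (mul_eq_zero.1 h2).resolve_left (by positivity)
      exact_mod_cast this)
    (by
      rintro rfl
      apply hz10
      rw [hz1']; funext k; simp)
    (by
      rintro rfl
      apply hv0
      rw [hv']; funext k; simp)
    W
    (by
      intro w hw c
      exact Finset.mem_Icc.1 (Fintype.mem_piFinset.1 (Finset.mem_filter.1 hw).1 c))
    (fun w hw => (Finset.mem_filter.1 hw).2)
  have h1 : E.ncard ≤ W.card := by
    refine (Set.ncard_le_ncard hsub (Finset.finite_toSet _)).trans ?_
    rw [Set.ncard_coe_finset]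
    exact Finset.card_image_le
  have h2 : (E.ncard : ℝ) ≤ ((2 * 3 ^ (N - 2)) ^ ((N - 2) * d) *
      ((N - 2) * d * (2 * B + 1)) ^ ((N - 2) * (d - 1)) : ℕ) := by
    exact_mod_cast h1.trans hWc
  refine h2.trans ?_
  push_cast
  rw [mul_assoc ((2 * 3 ^ (N - 2) : ℝ) ^ ((N - 2) * d)), ← mul_pow,
    mul_assoc (((N - 2 : ℕ) : ℝ) * d) 5]
  gcongr
  linarith
end
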